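/- arXiv:1003.1224 — 2 statements merged into one kernel-verified Lean document; each statement's English description precedes it below -/
import Mathlib

section
/- Let u be a uniformly recurrent infinite word over a finite alphabet A with k = #A letters, whose factor complexity satisfies C(n) = (k−1)n + 1 for all n ∈ ℕ. If every palindromic factor of u has exactly one palindromic extension (Property PE), then every factor of u has exactly k return words (Property R). -/
open List

/-- The factor of `u` of length `n` starting at position `i`. -/
def word {A : Type*} (u : ℕ → A) (i n : ℕ) : List A :=
  (List.range n).map (fun j => u (i + j))

/-- `w` occurs in `u` at position `i`. -/
def OccursAt {A : Type*} (u : ℕ → A) (w : List A) (i : ℕ) : Prop :=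
  w = word u i w.length

/-- `w` is a factor of the infinite word `u`. -/
def IsFactor {A : Type*} (u : ℕ → A) (w : List A) : Prop :=
  ∃ i, OccursAt u w i

/-- Every letter of the alphabet occurs in `u`. -/
def AllLettersOccur {A : Type*} (u : ℕ → A) : Prop :=
  ∀ a : A, ∃ i, u i = a

/-- The language of `u` is closed under reversal. -/
def ClosedUnderReversal {A : Type*} (u : ℕ → A) : Prop :=
  ∀ w : List A, IsFactor u w → IsFactor u w.reverse

/-- `u` is uniformly recurrent: every factor occurs in every window of some
bounded length. -/
def UniformlyRecurrent {A : Type*} (u : ℕ → A) : Prop :=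
  ∀ w : List A, IsFactor u w → ∃ N : ℕ, ∀ i : ℕ, ∃ j : ℕ,
    i ≤ j ∧ j < i + N ∧ OccursAt u w j

/-- Factor complexity: the number of factors of `u` of length `n`. -/
noncomputable def complexity {A : Type*} (u : ℕ → A) (n : ℕ) : ℕ :=
  Set.ncard {w : List A | w.length = n ∧ IsFactor u w}

/-- Palindromic complexity: the number of palindromic factors of `u` of
length `n`. -/
noncomputable def palComplexity {A : Type*} (u : ℕ → A) (n : ℕ) : ℕ :=
  Set.ncard {w : List A | w.length = n ∧ IsFactor u w ∧ w.reverse = w}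

/-- The number of distinct palindromic factors of a finite word
(the empty word included). -/
noncomputable def palCount {A : Type*} (w : List A) : ℕ :=
  Set.ncard {v : List A | v <:+: w ∧ v.reverse = v}

/-- `u` is rich in palindromes. -/
def Rich {A : Type*} (u : ℕ → A) : Prop :=
  ∀ w : List A, IsFactor u w → palCount w = w.length + 1

/-- `j < k` are two successive occurrences of `w` in `u`. -/
def SuccOccurrences {A : Type*} (u : ℕ → A) (w : List A) (j k : ℕ) : Prop :=
  OccursAt u w j ∧ OccursAt u w k ∧ j < k ∧
    ∀ l : ℕ, j < l → l < k → ¬ OccursAt u w l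

/-- The set of return words of the factor `w` in `u`. -/
def returnWords {A : Type*} (u : ℕ → A) (w : List A) : Set (List A) :=
  {v | ∃ j k : ℕ, SuccOccurrences u w j k ∧ v = word u j (k - j)}

/-- Left extensions of `w` in `u`. -/
def Lext {A : Type*} (u : ℕ → A) (w : List A) : Set A :=
  {a | IsFactor u (a :: w)}

/-- Right extensions of `w` in `u`. -/
def Rext {A : Type*} (u : ℕ → A) (w : List A) : Set A :=
  {b | IsFactor u (w ++ [b])}

/-- Bilateral extensions of `w` in `u`. -/
def Bext {A : Type*} (u : ℕ → A) (w : List A) : Set (A × A) :=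
  {p | IsFactor u (p.1 :: (w ++ [p.2]))}

/-- Palindromic extensions of a (palindromic) factor `w` of `u`. -/
def Pext {A : Type*} (u : ℕ → A) (w : List A) : Set (List A) :=
  {v | ∃ a : A, v = a :: (w ++ [a]) ∧ IsFactor u v}

/-- `w` is a bispecial factor of `u`. -/
def Bispecial {A : Type*} (u : ℕ → A) (w : List A) : Prop :=
  IsFactor u w ∧ 2 ≤ Set.ncard (Lext u w) ∧ 2 ≤ Set.ncard (Rext u w)

/-- The bilateral order of a factor `w` of `u`. -/
noncomputable def bilateralOrder {A : Type*} (u : ℕ → A) (w : List A) : ℤ :=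
  (Set.ncard (Bext u w) : ℤ) - Set.ncard (Rext u w) - Set.ncard (Lext u w) + 1

/-- `u` is eventually periodic. -/
def EventuallyPeriodic {A : Type*} (u : ℕ → A) : Prop :=
  ∃ p : ℕ, 0 < p ∧ ∃ N : ℕ, ∀ n : ℕ, N ≤ n → u (n + p) = u n

/-- `u` is aperiodic. -/
def Aperiodic {A : Type*} (u : ℕ → A) : Prop :=
  ¬ EventuallyPeriodic u

/-- `u` is (1-)balanced. -/
def IsBalanced {A : Type*} [DecidableEq A] (u : ℕ → A) : Prop :=
  ∀ a : A, ∀ w v : List A, IsFactor u w → IsFactor u v → w.length = v.length →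
    |(w.count a : ℤ) - (v.count a : ℤ)| ≤ 1


namespace PEProof

open Classical

theorem length_word {A : Type*} (u : ℕ → A) (i n : ℕ) : (word u i n).length = n := by
  simp [word]

theorem getElem_word {A : Type*} (u : ℕ → A) (i n p : ℕ) (h : p < (word u i n).length) :
    (word u i n)[p] = u (i + p) := by
  simp [word]

theorem word_add {A : Type*} (u : ℕ → A) (i m n : ℕ) :
    word u i (m + n) = word u i m ++ word u (i + m) n := by
  simp [word, List.range_add, Function.comp_def, add_assoc]

theorem word_zero {A : Type*} (u : ℕ → A) (i : ℕ) : word u i 0 = [] := rfl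

theorem word_one {A : Type*} (u : ℕ → A) (i : ℕ) : word u i 1 = [u i] := by
  simp [word]

theorem word_succ {A : Type*} (u : ℕ → A) (i n : ℕ) :
    word u i (n + 1) = word u i n ++ [u (i + n)] := by
  rw [word_add, word_one]

theorem word_succ' {A : Type*} (u : ℕ → A) (i n : ℕ) :
    word u i (n + 1) = u i :: word u (i + 1) n := by
  rw [add_comm, word_add, word_one]; rfl

theorem isFactor_word {A : Type*} (u : ℕ → A) (i n : ℕ) : IsFactor u (word u i n) :=
  ⟨i, by simp [OccursAt, length_word]⟩

theorem occ_append {A : Type*} (u : ℕ → A) (x y : List A) (i : ℕ) :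
    OccursAt u (x ++ y) i ↔ OccursAt u x i ∧ OccursAt u y (i + x.length) := by
  unfold OccursAt
  rw [List.length_append, word_add]
  constructor
  · intro h
    exact List.append_inj h (by simp [length_word])
  · rintro ⟨h1, h2⟩
    rw [← h1, ← h2]

theorem occ_word {A : Type*} (u : ℕ → A) (i n : ℕ) : OccursAt u (word u i n) i := by
  simp [OccursAt, length_word]

theorem occ_singleton {A : Type*} (u : ℕ → A) (a : A) (i : ℕ) :
    OccursAt u [a] i ↔ a = u i := by
  simp [OccursAt, word_one]

theorem occ_cons {A : Type*} (u : ℕ → A) (a : A) (y : List A) (i : ℕ) :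
    OccursAt u (a :: y) i ↔ a = u i ∧ OccursAt u y (i + 1) := by
  have := occ_append u [a] y i
  rw [occ_singleton] at this
  simpa using this

theorem factor_infix {A : Type*} {u : ℕ → A} {x y : List A} (h : x <:+: y)
    (hy : IsFactor u y) : IsFactor u x := by
  obtain ⟨s, t, rfl⟩ := h
  obtain ⟨i, hi⟩ := hy
  rw [occ_append, occ_append] at hi
  exact ⟨_, hi.1.2⟩

theorem occ_ge {A : Type*} {u : ℕ → A} (hur : UniformlyRecurrent u) {w : List A}
    (hw : IsFactor u w) (m : ℕ) : ∃ j, m ≤ j ∧ OccursAt u w j := by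
  obtain ⟨N, hN⟩ := hur w hw
  obtain ⟨j, h1, _, h3⟩ := hN m
  exact ⟨j, h1, h3⟩

/-! Finsets of factors and extensions -/

noncomputable def LF {A : Type*} [Fintype A] (u : ℕ → A) (n : ℕ) : Finset (List A) :=
  (List.finite_length_eq A n).toFinset.filter (fun w => IsFactor u w)

theorem mem_LF {A : Type*} [Fintype A] {u : ℕ → A} {n : ℕ} {w : List A} :
    w ∈ LF u n ↔ w.length = n ∧ IsFactor u w := by
  simp [LF]

theorem card_LF {A : Type*} [Fintype A] (u : ℕ → A) (n : ℕ) :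
    (LF u n).card = complexity u n := by
  unfold complexity
  rw [← Set.ncard_coe_finset]
  congr 1
  ext w
  simp [mem_LF]

noncomputable def rx {A : Type*} [Fintype A] (u : ℕ → A) (w : List A) : Finset A :=
  Finset.univ.filter (fun b => IsFactor u (w ++ [b]))

noncomputable def lx {A : Type*} [Fintype A] (u : ℕ → A) (w : List A) : Finset A :=
  Finset.univ.filter (fun b => IsFactor u (b :: w))

noncomputable def bx {A : Type*} [Fintype A] (u : ℕ → A) (w : List A) : Finset (A × A) :=
  Finset.univ.filter (fun p => IsFactor u (p.1 :: (w ++ [p.2])))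

theorem mem_rx {A : Type*} [Fintype A] {u : ℕ → A} {w : List A} {b : A} :
    b ∈ rx u w ↔ IsFactor u (w ++ [b]) := by simp [rx]

theorem mem_lx {A : Type*} [Fintype A] {u : ℕ → A} {w : List A} {b : A} :
    b ∈ lx u w ↔ IsFactor u (b :: w) := by simp [lx]

theorem mem_bx {A : Type*} [Fintype A] {u : ℕ → A} {w : List A} {p : A × A} :
    p ∈ bx u w ↔ IsFactor u (p.1 :: (w ++ [p.2])) := by simp [bx]

theorem sum_rx {A : Type*} [Fintype A] (u : ℕ → A) (n : ℕ) :
    ∑ w ∈ LF u n, (rx u w).card = (LF u (n + 1)).card := by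
  rw [← Finset.card_sigma]
  refine Finset.card_bij (fun p _ => p.1 ++ [p.2]) ?_ ?_ ?_
  · rintro ⟨w, b⟩ h
    simp only [Finset.mem_sigma, mem_LF, mem_rx] at h ⊢
    exact ⟨by simp [h.1.1], h.2⟩
  · rintro ⟨w, b⟩ _ ⟨w', b'⟩ _ h
    simp only at h
    obtain ⟨h1, h2⟩ := List.append_inj' h rfl
    simp at h2
    subst h1 h2
    rfl
  · intro x hx
    rw [mem_LF] at hx
    rcases List.eq_nil_or_concat x with rfl | ⟨s, b, rfl⟩
    · simp at hx
    · rw [List.concat_eq_append] at *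
      refine ⟨⟨s, b⟩, ?_, rfl⟩
      simp only [Finset.mem_sigma, mem_LF, mem_rx]
      refine ⟨⟨by simpa using hx.1, factor_infix ?_ hx.2⟩, hx.2⟩
      exact (List.prefix_append s [b]).isInfix

theorem sum_lx_gen {A : Type*} [Fintype A] (u : ℕ → A) (n : ℕ) (q : List A → Prop) [DecidablePred q]
    (hq : ∀ a v, v.length = n → IsFactor u (a :: v) → (q (a :: v) ↔ q v)) (f : List A → ℤ) :
    ∑ w ∈ (LF u n).filter q, ∑ a ∈ lx u w, f (a :: w) =
      ∑ w ∈ (LF u (n + 1)).filter q, f w := by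
  rw [Finset.sum_sigma']
  refine Finset.sum_bij (fun p _ => p.2 :: p.1) ?_ ?_ ?_ ?_
  · rintro ⟨w, b⟩ h
    simp only [Finset.mem_sigma, Finset.mem_filter, mem_LF, mem_lx] at h ⊢
    exact ⟨⟨by simp [h.1.1], h.2⟩, (hq _ _ h.1.1.1 h.2).2 h.1.2⟩
  · rintro ⟨w, b⟩ _ ⟨w', b'⟩ _ h
    simp only [List.cons.injEq] at h
    obtain ⟨h1, h2⟩ := h
    subst h1 h2
    rfl
  · intro x hx
    rw [Finset.mem_filter, mem_LF] at hx
    rcases x with _ | ⟨b, s⟩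
    · simp at hx
    · refine ⟨⟨s, b⟩, ?_, rfl⟩
      simp only [Finset.mem_sigma, Finset.mem_filter, mem_LF, mem_lx]
      have hl : s.length = n := by simpa using hx.1.1
      refine ⟨⟨⟨hl, factor_infix ?_ hx.1.2⟩, (hq _ _ hl hx.1.2).1 hx.2⟩, hx.1.2⟩
      exact (List.suffix_cons b s).isInfix
  · intros; rfl

theorem card_bx {A : Type*} [Fintype A] (u : ℕ → A) (w : List A) :
    ∑ a ∈ lx u w, (rx u (a :: w)).card = (bx u w).card := by
  rw [← Finset.card_sigma]
  refine Finset.card_bij (fun p _ => (p.1, p.2)) ?_ ?_ ?_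
  · rintro ⟨w, b⟩ h
    simp only [Finset.mem_sigma, mem_lx, mem_rx, mem_bx] at h ⊢
    simpa using h.2
  · rintro ⟨w, b⟩ _ ⟨w', b'⟩ _ h
    simpa using h
  · rintro ⟨a, b⟩ hx
    rw [mem_bx] at hx
    refine ⟨⟨a, b⟩, ?_, rfl⟩
    simp only [Finset.mem_sigma, mem_lx, mem_rx]
    refine ⟨factor_infix ?_ hx, by simpa using hx⟩
    exact (List.prefix_append (a :: w) [b]).isInfix

/-- bilateral order times: if all orders are nonnegative, they vanish. -/
theorem neutral_of_nonneg {A : Type*} [Fintype A] [Nonempty A] (u : ℕ → A)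
    (hC : ∀ n : ℕ, complexity u n = (Fintype.card A - 1) * n + 1)
    (hm : ∀ w, IsFactor u w → (lx u w).card + (rx u w).card ≤ (bx u w).card + 1)
    (w : List A) (hw : IsFactor u w) :
    (lx u w).card + (rx u w).card = (bx u w).card + 1 := by
  have h1 : ∑ w ∈ LF u w.length, (rx u w).card = (LF u (w.length + 1)).card := sum_rx u _
  have h2 : ∑ w ∈ LF u w.length, (lx u w).card = (LF u (w.length + 1)).card := by
    have := sum_lx_gen u w.length (fun _ => True) (by simp) (fun _ => 1)
    simp at this
    exact_mod_cast this
  have h3 : ∑ w ∈ LF u w.length, (bx u w).card = (LF u (w.length + 2)).card := by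
    rw [← sum_rx]
    have := sum_lx_gen u w.length (fun _ => True) (by simp) (fun w => ((rx u w).card : ℤ))
    simp only [Finset.filter_true] at this
    have h4 : (∑ w ∈ LF u w.length, (bx u w).card : ℤ)
      = ∑ w ∈ LF u w.length, ∑ a ∈ lx u w, ((rx u (a :: w)).card : ℤ) := by
      refine Finset.sum_congr rfl fun w _ => ?_
      rw [← card_bx]; push_cast; rfl
    rw [this] at h4
    exact_mod_cast h4
  have h5 : ∑ w ∈ LF u w.length, ((lx u w).card + (rx u w).card)
      = ∑ w ∈ LF u w.length, ((bx u w).card + 1) := by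
    rw [Finset.sum_add_distrib, Finset.sum_add_distrib, h1, h2, h3]
    simp only [Finset.sum_const, smul_eq_mul, mul_one, card_LF, hC]
    ring
  have h6 := (Finset.sum_eq_sum_iff_of_le (fun x hx => hm x (mem_LF.1 hx).2)).1 h5
  exact h6 w (mem_LF.2 ⟨rfl, hw⟩)

theorem lx_rx_sum {A : Type*} [Fintype A] (u : ℕ → A) 
    (hn : ∀ w, IsFactor u w → (lx u w).card + (rx u w).card = (bx u w).card + 1)
    (s : List A) (hs : IsFactor u s) (d : ℕ) :
    ∑ v ∈ (LF u (s.length + d)).filter (fun v => s <:+ v), (((rx u v).card : ℤ) - 1)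
      = (rx u s).card - 1 := by
  induction d with
  | zero =>
    have : (LF u (s.length + 0)).filter (fun v => s <:+ v) = {s} := by
      ext v
      simp only [Finset.mem_filter, mem_LF, Finset.mem_singleton, add_zero]
      constructor
      · rintro ⟨⟨h1, _⟩, h2⟩
        exact (h2.eq_of_length h1.symm).symm
      · rintro rfl
        exact ⟨⟨rfl, hs⟩, List.suffix_rfl⟩
    rw [this]; simp
  | succ d ih =>
    rw [← ih, ← add_assoc, 
      ← sum_lx_gen u (s.length + d) (fun v => s <:+ v) ?_ (fun v => ((rx u v).card : ℤ) - 1)]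
    · refine Finset.sum_congr rfl fun v hv => ?_
      rw [Finset.mem_filter, mem_LF] at hv
      have h1 := hn v hv.1.2
      have h2 := card_bx u v
      rw [Finset.sum_sub_distrib]
      simp only [Finset.sum_const, nsmul_eq_mul, mul_one]
      have h2' : (∑ a ∈ lx u v, ((rx u (a :: v)).card : ℤ)) = (bx u v).card := by exact_mod_cast h2
      rw [h2']
      omega
    · intro a v hv _
      rw [List.suffix_cons_iff]
      constructor
      · rintro (h | h)
        · rw [h] at hv; simp at hv; omega
        · exact h
      · exact Or.inr

/-! Return words -/

/-- `s` starts with `w` and contains no other occurrence of `w`. -/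
def Node {A : Type*} (w s : List A) : Prop :=
  w <+: s ∧ ∀ y, y <:+ s → w <+: y → y = s

/-- `x` is a complete return word of `w` -/
def CRet {A : Type*} (w x : List A) : Prop :=
  w <+: x ∧ w <:+ x ∧ x ≠ w ∧ ∀ y, y <:+ x → w <+: y → y = x ∨ y = w

theorem exists_node {A : Type*} (w v : List A) (h : w <:+: v) : ∃ s, s <:+ v ∧ Node w s := by
  induction v with
  | nil =>
    refine ⟨[], List.suffix_rfl, ?_, ?_⟩
    · simp at h; simp [h]
    · intro y hy _; simpa using hy
  | cons a v ih =>
    by_cases hv : w <:+: v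
    · obtain ⟨s, h1, h2⟩ := ih hv
      exact ⟨s, h1.trans (List.suffix_cons a v), h2⟩
    · refine ⟨a :: v, List.suffix_rfl, ?_, ?_⟩
      · rw [List.infix_cons_iff] at h
        exact h.resolve_right hv
      · intro y hy hwy
        rw [List.suffix_cons_iff] at hy
        rcases hy with h1 | h1
        · exact h1
        · exact absurd (hwy.isInfix.trans h1.isInfix) hv

theorem node_unique {A : Type*} {w v s t : List A} (hs : s <:+ v) (ht : t <:+ v)
    (h1 : Node w s) (h2 : Node w t) : s = t := by
  rcases List.suffix_or_suffix_of_suffix hs ht with h | h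
  · exact h2.2 s h h1.1
  · exact (h1.2 t h h2.1).symm

theorem node_child {A : Type*} {w s : List A} (h : Node w s) (b : A) :
    (Node w (s ++ [b]) ∧ s ++ [b] ≠ w) ∨ CRet w (s ++ [b]) := by
  have hne : s ++ [b] ≠ w := by
    intro e
    have := h.1.length_le
    rw [← e] at this
    simp at this
  have hp : w <+: s ++ [b] := h.1.trans (List.prefix_append _ _)
  have key : ∀ y, y <:+ s ++ [b] → w <+: y → y = s ++ [b] ∨ y = w := by
    intro y hy hwy
    rw [List.suffix_concat_iff] at hy
    rcases hy with rfl | ⟨t, rfl, ht⟩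
    · right; exact (List.prefix_nil.1 hwy).symm
    · rw [List.prefix_concat_iff] at hwy
      rcases hwy with h1 | h1
      · right; exact h1.symm
      · left; rw [h.2 t ht h1]
  by_cases hw : w <:+ s ++ [b]
  · right
    exact ⟨hp, hw, hne, key⟩
  · left
    refine ⟨⟨hp, ?_⟩, hne⟩
    intro y hy hwy
    rcases key y hy hwy with h1 | h1
    · exact h1
    · rw [h1] at hy; exact absurd hy hw

theorem node_parent {A : Type*} {w s : List A} {b : A}
    (h : (Node w (s ++ [b]) ∧ s ++ [b] ≠ w) ∨ CRet w (s ++ [b])) : Node w s := by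
  have hne : s ++ [b] ≠ w := by
    rcases h with h | h
    · exact h.2
    · exact h.2.2.1
  have hp : w <+: s ++ [b] := by
    rcases h with h | h
    · exact h.1.1
    · exact h.1
  have hp' : w <+: s := by
    rw [List.prefix_concat_iff] at hp
    exact hp.resolve_left (fun e => hne e.symm)
  refine ⟨hp', ?_⟩
  intro y hy hwy
  have hy' : y ++ [b] <:+ s ++ [b] := by
    obtain ⟨t, rfl⟩ := hy
    exact ⟨t, by simp⟩
  have hwy' : w <+: y ++ [b] := hwy.trans (List.prefix_append _ _)
  have key : y ++ [b] = s ++ [b] ∨ y ++ [b] = w := by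
    rcases h with h | h
    · left; exact h.1.2 _ hy' hwy'
    · exact h.2.2.2 _ hy' hwy'
  rcases key with h1 | h1
  · exact List.append_cancel_right h1
  · have := hwy.length_le
    rw [← h1] at this
    simp at this

theorem node_cret_disjoint {A : Type*} {w x : List A} (h1 : Node w x) (h2 : CRet w x) : False :=
  h2.2.2.1 (h1.2 w h2.2.1 List.prefix_rfl).symm

theorem node_self {A : Type*} (w : List A) : Node w w :=
  ⟨List.prefix_rfl, fun _ hy hwy => hy.eq_of_length_le hwy.length_le⟩

theorem uniform_window {A : Type*} {u : ℕ → A} (hur : UniformlyRecurrent u) {w : List A}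
    (hw : IsFactor u w) : ∃ N, ∀ v, IsFactor u v → N ≤ v.length → w <:+: v := by
  obtain ⟨N, hN⟩ := hur w hw
  refine ⟨N + w.length, fun v ⟨i, hi⟩ hl => ?_⟩
  obtain ⟨j, h1, h2, h3⟩ := hN i
  have e : v.length = (j - i) + (w.length + (v.length - (j - i) - w.length)) := by omega
  unfold OccursAt at hi h3
  rw [e, word_add, word_add] at hi
  have e2 : i + (j - i) = j := by omega
  rw [e2, ← h3, ← List.append_assoc] at hi
  exact ⟨_, _, hi.symm⟩

theorem prefix_suffix_word {A : Type*} {u : ℕ → A} {i n : ℕ} {y : List A}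
    (hy : y <:+ word u i n) : ∃ p, p + y.length = n ∧ OccursAt u y (i + p) := by
  obtain ⟨t, ht⟩ := hy
  have hl : t.length + y.length = n := by
    rw [← length_word u i n, ← ht, List.length_append]
  refine ⟨t.length, hl, ?_⟩
  have := occ_word u i n
  rw [← ht, occ_append] at this
  exact this.2

theorem returnWords_iff {A : Type*} {u : ℕ → A} {w v : List A} :
    v ∈ returnWords u w ↔ (CRet w (v ++ w) ∧ IsFactor u (v ++ w)) := by
  constructor
  · rintro ⟨j, k, ⟨h1, h2, h3, h4⟩, rfl⟩
    have hx : word u j (k - j) ++ w = word u j (k - j + w.length) := by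
      rw [word_add]
      have : j + (k - j) = k := by omega
      rw [this, ← h2]
    have hx' : word u j (k - j + w.length) = w ++ word u (j + w.length) (k - j) := by
      rw [add_comm, word_add, ← h1]
    refine ⟨⟨?_, List.suffix_append _ _, ?_, ?_⟩, ?_⟩
    · rw [hx, hx']; exact List.prefix_append _ _
    · intro e
      have := congrArg List.length e
      simp [length_word] at this
      omega
    · intro y hy hwy
      rw [hx] at hy
      obtain ⟨p, hp, ho⟩ := prefix_suffix_word hy
      have how : OccursAt u w (j + p) := by
        obtain ⟨t, rfl⟩ := hwy
        exact ((occ_append _ _ _ _).1 ho).1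
      have hle := hwy.length_le
      by_cases hp0 : p = 0
      · left
        rw [hx]
        apply hy.eq_of_length
        rw [length_word]; omega
      · by_cases hpk : j + p < k
        · exact absurd how (h4 _ (by omega) hpk)
        · right
          exact (hwy.eq_of_length (by omega)).symm
    · rw [hx]; exact isFactor_word _ _ _
  · rintro ⟨⟨h1, h2, h3, h4⟩, ⟨j, hj⟩⟩
    have hv : v ≠ [] := by rintro rfl; simp at h3
    have hvl : 0 < v.length := List.length_pos_iff.2 hv
    have hj' := (occ_append _ _ _ _).1 hj
    refine ⟨j, j + v.length, ⟨?_, hj'.2, by omega, ?_⟩, ?_⟩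
    · obtain ⟨t, ht⟩ := h1
      rw [← ht] at hj
      exact ((occ_append _ _ _ _).1 hj).1
    · intro l hl1 hl2 hl
      have e : v.length + w.length = (l - j) + (w.length + (j + v.length - l)) := by omega
      have hj2 := hj
      unfold OccursAt at hj2
      rw [List.length_append, e, word_add] at hj2
      have e2 : j + (l - j) = l := by omega
      rw [e2] at hj2
      have hsuf : word u l (w.length + (j + v.length - l)) <:+ v ++ w := ⟨_, hj2.symm⟩
      have hpre : w <+: word u l (w.length + (j + v.length - l)) := by
        rw [word_add, ← hl]
        exact List.prefix_append _ _
      rcases h4 _ hsuf hpre with h5 | h5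
      · have := congrArg List.length h5
        rw [length_word, List.length_append] at this
        omega
      · have := congrArg List.length h5
        rw [length_word] at this
        omega
    · have := hj'.1
      simpa [OccursAt] using this

theorem ncard_returnWords {A : Type*} [Fintype A] [Nonempty A] (u : ℕ → A)
    (hur : UniformlyRecurrent u)
    (hC : ∀ n : ℕ, complexity u n = (Fintype.card A - 1) * n + 1)
    (hn : ∀ w, IsFactor u w → (lx u w).card + (rx u w).card = (bx u w).card + 1)
    (w : List A) (hw : IsFactor u w) :
    Set.ncard (returnWords u w) = Fintype.card A := by
  obtain ⟨N, hN⟩ := uniform_window hur hw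
  have hnode : ∀ s, IsFactor u s → Node w s → s.length ≤ N := by
    intro s hs h
    by_contra hlt
    push Not at hlt
    rcases s with _ | ⟨a, s⟩
    · simp at hlt
    · simp at hlt
      have hinf : w <:+: s := hN s (factor_infix (List.suffix_cons a s).isInfix hs) (by omega)
      obtain ⟨t, ht1, ht2⟩ := exists_node w s hinf
      have := h.2 t (ht1.trans (List.suffix_cons a s)) ht2.1
      have hl := ht1.length_le
      rw [this] at hl
      simp at hl
  -- finsets
  let F : Finset (List A) := (Finset.range (N + 2)).biUnion (fun n => LF u n)
  have hF : ∀ x, x ∈ F ↔ x.length ≤ N + 1 ∧ IsFactor u x := by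
    intro x
    simp only [F, Finset.mem_biUnion, Finset.mem_range, mem_LF]
    constructor
    · rintro ⟨n, h1, h2, h3⟩; exact ⟨by omega, h3⟩
    · rintro ⟨h1, h2⟩; exact ⟨_, by omega, rfl, h2⟩
  let T := F.filter (fun s => Node w s)
  let R := F.filter (fun s => CRet w s)
  have hT : ∀ s, s ∈ T ↔ IsFactor u s ∧ Node w s := by
    intro s
    simp only [T, Finset.mem_filter, hF]
    constructor
    · rintro ⟨⟨_, h1⟩, h2⟩; exact ⟨h1, h2⟩
    · rintro ⟨h1, h2⟩; exact ⟨⟨by have := hnode s h1 h2; omega, h1⟩, h2⟩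
  have hR : ∀ s, s ∈ R ↔ IsFactor u s ∧ CRet w s := by
    intro s
    simp only [R, Finset.mem_filter, hF]
    constructor
    · rintro ⟨⟨_, h1⟩, h2⟩; exact ⟨h1, h2⟩
    · rintro ⟨h1, h2⟩
      refine ⟨⟨?_, h1⟩, h2⟩
      rcases List.eq_nil_or_concat s with rfl | ⟨s, b, rfl⟩
      · simp
      · rw [List.concat_eq_append] at *
        have h3 := node_parent (Or.inr h2)
        have := hnode s (factor_infix (List.prefix_append s [b]).isInfix h1) h3
        simp; exact this
  -- the tree count
  have htree : ∑ s ∈ T, (rx u s).card = ((T.erase w) ∪ R).card := by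
    rw [← Finset.card_sigma]
    refine Finset.card_bij (fun p _ => p.1 ++ [p.2]) ?_ ?_ ?_
    · rintro ⟨s, b⟩ h
      simp only [Finset.mem_sigma, hT, mem_rx] at h
      simp only [Finset.mem_union, Finset.mem_erase, hT, hR]
      rcases node_child h.1.2 b with h1 | h1
      · left; exact ⟨h1.2, h.2, h1.1⟩
      · right; exact ⟨h.2, h1⟩
    · rintro ⟨w, b⟩ _ ⟨w', b'⟩ _ h
      simp only at h
      obtain ⟨h1, h2⟩ := List.append_inj' h rfl
      simp at h2
      subst h1 h2
      rfl
    · intro x hx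
      simp only [Finset.mem_union, Finset.mem_erase, hT, hR] at hx
      have hx1 : (Node w x ∧ x ≠ w) ∨ CRet w x := by tauto
      have hx2 : IsFactor u x := by tauto
      rcases List.eq_nil_or_concat x with rfl | ⟨s, b, rfl⟩
      · exfalso
        rcases hx1 with h | h
        · exact h.2 (List.prefix_nil.1 h.1.1).symm
        · exact h.2.2.1 (List.prefix_nil.1 h.1).symm
      · rw [List.concat_eq_append] at *
        refine ⟨⟨s, b⟩, ?_, rfl⟩
        simp only [Finset.mem_sigma, hT, mem_rx]
        exact ⟨⟨factor_infix (List.prefix_append s [b]).isInfix hx2, node_parent hx1⟩, hx2⟩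
  have hdisj : Disjoint (T.erase w) R := by
    rw [Finset.disjoint_left]
    intro x h1 h2
    rw [Finset.mem_erase, hT] at h1
    rw [hR] at h2
    exact node_cret_disjoint h1.2.2 h2.2
  have hwT : w ∈ T := (hT w).2 ⟨hw, node_self w⟩
  rw [Finset.card_union_of_disjoint hdisj, Finset.card_erase_of_mem hwT] at htree
  have hTpos : 0 < T.card := Finset.card_pos.2 ⟨w, hwT⟩
  -- the level count
  have hlevel : ∑ v ∈ LF u N, (((rx u v).card : ℤ) - 1) = ∑ s ∈ T, (((rx u s).card : ℤ) - 1) := by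
    have h1 : ∀ s ∈ T, (((rx u s).card : ℤ) - 1) =
        ∑ v ∈ (LF u N).filter (fun v => s <:+ v), (((rx u v).card : ℤ) - 1) := by
      intro s hs
      rw [hT] at hs
      have h2 := hnode s hs.1 hs.2
      have h3 := lx_rx_sum u hn s hs.1 (N - s.length)
      rw [show s.length + (N - s.length) = N by omega] at h3
      exact h3.symm
    rw [Finset.sum_congr rfl h1, ← Finset.sum_biUnion]
    · refine Finset.sum_congr ?_ (fun _ _ => rfl)
      ext v
      simp only [Finset.mem_biUnion, Finset.mem_filter]
      constructor
      · intro hv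
        have hv' := mem_LF.1 hv
        obtain ⟨s, hs1, hs2⟩ := exists_node w v (hN v hv'.2 hv'.1.ge)
        exact ⟨s, (hT s).2 ⟨factor_infix hs1.isInfix hv'.2, hs2⟩, hv, hs1⟩
      · rintro ⟨s, _, h, _⟩; exact h
    · intro s hs t ht hst
      rw [Function.onFun, Finset.disjoint_left]
      intro v hv1 hv2
      rw [Finset.mem_filter] at hv1 hv2
      exact hst (node_unique hv1.2 hv2.2 ((hT s).1 hs).2 ((hT t).1 ht).2)
  have hsum := sum_rx u N
  rw [Finset.sum_sub_distrib, Finset.sum_sub_distrib] at hlevel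
  simp only [Finset.sum_const, nsmul_eq_mul, mul_one] at hlevel
  have e1 : (∑ v ∈ LF u N, ((rx u v).card : ℤ)) = (LF u (N + 1)).card := by exact_mod_cast hsum
  have e2 : (∑ v ∈ T, ((rx u v).card : ℤ)) = ((T.card - 1 + R.card : ℕ) : ℤ) := by
    exact_mod_cast htree
  rw [e1, e2] at hlevel
  simp only [card_LF, hC] at hlevel
  have hA : 0 < Fintype.card A := Fintype.card_pos
  have hmul : (Fintype.card A - 1) * (N + 1) = (Fintype.card A - 1) * N + (Fintype.card A - 1) := by
    ring
  rw [hmul] at hlevel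
  have hRc : R.card = Fintype.card A := by omega
  rw [← hRc, ← Set.ncard_coe_finset]
  refine Set.ncard_congr (fun v _ => v ++ w) ?_ ?_ ?_
  · intro v hv
    rw [returnWords_iff] at hv
    exact Finset.mem_coe.2 ((hR _).2 ⟨hv.2, hv.1⟩)
  · intro v v' _ _ h
    exact List.append_cancel_right h
  · intro x hx
    have hx := (hR _).1 (Finset.mem_coe.1 hx)
    obtain ⟨v, rfl⟩ := hx.2.2.1
    exact ⟨v, returnWords_iff.2 ⟨hx.2, hx.1⟩, rfl⟩

/-! Palindromes -/

theorem pal_unique {A : Type*} {u : ℕ → A}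
    (hPE : ∀ w : List A, IsFactor u w → w.reverse = w → Set.ncard (Pext u w) = 1)
    {w : List A} (hw : IsFactor u w) (hp : w.reverse = w) :
    ∃ a, IsFactor u (a :: (w ++ [a])) ∧ ∀ b, IsFactor u (b :: (w ++ [b])) → b = a := by
  obtain ⟨v, hv⟩ := Set.ncard_eq_one.1 (hPE w hw hp)
  have hmem : v ∈ Pext u w := by rw [hv]; rfl
  obtain ⟨a, rfl, ha⟩ := hmem
  refine ⟨a, ha, fun b hb => ?_⟩
  have : (b :: (w ++ [b])) ∈ Pext u w := ⟨b, rfl, hb⟩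
  rw [hv, Set.mem_singleton_iff] at this
  exact (List.cons.inj this).1

theorem exists_long_pal {A : Type*} {u : ℕ → A}
    (hPE : ∀ w : List A, IsFactor u w → w.reverse = w → Set.ncard (Pext u w) = 1) (n : ℕ) :
    ∃ w, IsFactor u w ∧ w.reverse = w ∧ n ≤ w.length := by
  induction n with
  | zero => exact ⟨[], ⟨0, rfl⟩, rfl, le_rfl⟩
  | succ n ih =>
    obtain ⟨w, h1, h2, h3⟩ := ih
    obtain ⟨a, ha, _⟩ := pal_unique hPE h1 h2
    exact ⟨_, ha, by simp [h2], by simp; omega⟩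

theorem closed_rev {A : Type*} {u : ℕ → A} (hur : UniformlyRecurrent u)
    (hPE : ∀ w : List A, IsFactor u w → w.reverse = w → Set.ncard (Pext u w) = 1) :
    ClosedUnderReversal u := by
  intro w hw
  obtain ⟨N, hN⟩ := uniform_window hur hw
  obtain ⟨p, h1, h2, h3⟩ := exists_long_pal hPE N
  have := hN p h1 h3
  rw [← List.reverse_infix, h2] at this
  exact factor_infix this h1

noncomputable def PF {A : Type*} [Fintype A] (u : ℕ → A) (n : ℕ) : Finset (List A) :=
  (LF u n).filter (fun w => w.reverse = w)

theorem mem_PF {A : Type*} [Fintype A] {u : ℕ → A} {n : ℕ} {w : List A} :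
    w ∈ PF u n ↔ (w.length = n ∧ IsFactor u w) ∧ w.reverse = w := by
  simp [PF, mem_LF]

theorem card_PF_step {A : Type*} [Fintype A] {u : ℕ → A}
    (hPE : ∀ w : List A, IsFactor u w → w.reverse = w → Set.ncard (Pext u w) = 1) (n : ℕ) :
    (PF u (n + 2)).card = (PF u n).card := by
  symm
  have hex : ∀ w ∈ PF u n, ∃ a, IsFactor u (a :: (w ++ [a])) ∧
      ∀ b, IsFactor u (b :: (w ++ [b])) → b = a := by
    intro w hw
    rw [mem_PF] at hw
    exact pal_unique hPE hw.1.2 hw.2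
  choose f hf1 hf2 using hex
  refine Finset.card_bij (fun w hw => f w hw :: (w ++ [f w hw])) ?_ ?_ ?_
  · intro w hw
    have h := mem_PF.1 hw
    rw [mem_PF]
    refine ⟨⟨by simp [h.1.1], hf1 w hw⟩, by simp [h.2]⟩
  · intro w hw w' hw' h
    have := (List.cons.inj h).2
    exact (List.append_inj' this rfl).1
  · intro x hx
    have h := mem_PF.1 hx
    rcases x with _ | ⟨a, x⟩
    · simp at h
    rcases List.eq_nil_or_concat x with rfl | ⟨w, b, rfl⟩
    · simp at h
    rw [List.concat_eq_append] at *
    have h2 := h.2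
    simp only [List.reverse_cons, List.reverse_append, List.reverse_nil, List.nil_append,
      List.cons_append, List.cons.injEq] at h2
    obtain ⟨rfl, h3⟩ := h2
    have h4 := (List.append_inj' h3 rfl).1
    have hw : w ∈ PF u n := by
      rw [mem_PF]
      refine ⟨⟨by simpa using h.1.1, factor_infix ⟨[b], [b], by simp⟩ h.1.2⟩, h4⟩
    refine ⟨w, hw, ?_⟩
    rw [← hf2 w hw b h.1.2]

theorem card_PF_sum {A : Type*} [Fintype A] {u : ℕ → A} (hall : AllLettersOccur u)
    (hPE : ∀ w : List A, IsFactor u w → w.reverse = w → Set.ncard (Pext u w) = 1) (n : ℕ) :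
    (PF u n).card + (PF u (n + 1)).card = Fintype.card A + 1 := by
  induction n with
  | zero =>
    have h0 : PF u 0 = {[]} := by
      ext w
      rw [mem_PF, Finset.mem_singleton]
      constructor
      · rintro ⟨⟨h, _⟩, _⟩; simpa using h
      · rintro rfl; exact ⟨⟨rfl, ⟨0, rfl⟩⟩, rfl⟩
    have h1 : PF u 1 = Finset.univ.image (fun a => [a]) := by
      ext w
      rw [mem_PF]
      simp only [Finset.mem_image, Finset.mem_univ, true_and]
      constructor
      · rintro ⟨⟨h, _⟩, _⟩
        obtain ⟨a, rfl⟩ := List.length_eq_one_iff.1 h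
        exact ⟨a, rfl⟩
      · rintro ⟨a, rfl⟩
        obtain ⟨i, hi⟩ := hall a
        exact ⟨⟨rfl, ⟨i, (occ_singleton _ _ _).2 hi.symm⟩⟩, rfl⟩
    rw [h0, h1, Finset.card_image_of_injective]
    · simp [add_comm]
    · intro a b h; simpa using h
  | succ n ih =>
    rw [card_PF_step hPE, ← ih, add_comm]

/-! Classes modulo reversal -/

noncomputable def cls {A : Type*} (w : List A) : List A :=
  Classical.epsilon (fun x => x = w ∨ x = w.reverse)

theorem cls_spec {A : Type*} (w : List A) : cls w = w ∨ cls w = w.reverse :=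
  Classical.epsilon_spec (p := fun x => x = w ∨ x = w.reverse) ⟨w, Or.inl rfl⟩

theorem cls_reverse {A : Type*} (w : List A) : cls w.reverse = cls w := by
  unfold cls
  congr 1
  funext x
  rw [List.reverse_reverse, or_comm]

theorem cls_eq_iff {A : Type*} {x y : List A} : cls x = cls y ↔ x = y ∨ x = y.reverse := by
  constructor
  · intro h
    rcases cls_spec x with h1 | h1 <;> rcases cls_spec y with h2 | h2 <;> rw [h1, h2] at h
    · exact Or.inl h
    · exact Or.inr h
    · right; rw [← h, List.reverse_reverse]
    · left; exact List.reverse_injective h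
  · rintro (rfl | rfl)
    · rfl
    · exact cls_reverse y

theorem card_cls {A : Type*} (S : Finset (List A)) (hS : ∀ w ∈ S, w.reverse ∈ S) :
    2 * (S.image cls).card = S.card + (S.filter (fun w => w.reverse = w)).card := by
  have h1 : S.card = ∑ b ∈ S.image cls, (S.filter (fun x => cls x = b)).card :=
    Finset.card_eq_sum_card_fiberwise (fun x hx => Finset.mem_image_of_mem _ hx)
  have h2 : (S.filter (fun w => w.reverse = w)).card = ∑ b ∈ S.image cls,
      ((S.filter (fun w => w.reverse = w)).filter (fun x => cls x = b)).card :=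
    Finset.card_eq_sum_card_fiberwise
      (fun x hx => Finset.mem_image_of_mem _ (Finset.mem_filter.1 hx).1)
  rw [h1, h2, ← Finset.sum_add_distrib, mul_comm, ← smul_eq_mul, ← Finset.sum_const]
  refine Finset.sum_congr rfl ?_
  intro b hb
  obtain ⟨w, hw, rfl⟩ := Finset.mem_image.1 hb
  have e1 : S.filter (fun x => cls x = cls w) = {w, w.reverse} := by
    ext x
    simp only [Finset.mem_filter, cls_eq_iff, Finset.mem_insert, Finset.mem_singleton]
    constructor
    · rintro ⟨_, h⟩; exact h
    · rintro (rfl | rfl)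
      · exact ⟨hw, Or.inl rfl⟩
      · exact ⟨hS _ hw, Or.inr rfl⟩
  rw [Finset.filter_filter, Finset.filter_and, Finset.inter_comm, ← Finset.filter_mem_eq_inter]
  rw [e1]
  by_cases hp : w.reverse = w
  · have : ({w, w.reverse} : Finset (List A)) = {w} := by rw [hp]; simp
    rw [this]
    simp [Finset.filter_singleton, hp, hw]
  · rw [Finset.card_pair (fun h => hp h.symm)]
    have : Finset.filter (fun a => a ∈ ({w, w.reverse} : Finset (List A)))
        (S.filter (fun w => w.reverse = w)) = ∅ := by
      ext x
      simp only [Finset.mem_filter, Finset.mem_insert, Finset.mem_singleton, Finset.notMem_empty,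
        iff_false, not_and]
      rintro ⟨_, h1⟩ (rfl | rfl)
      · exact hp h1
      · rw [List.reverse_reverse] at h1; exact hp h1.symm
    simp [Finset.filter_eq_empty_iff] at this ⊢
    grind

/-! The Rauzy graph modulo reversal -/

noncomputable def VS {A : Type*} [Fintype A] (u : ℕ → A) (n : ℕ) : Finset (List A) :=
  (LF u n).image cls

theorem word_mem_LF {A : Type*} [Fintype A] (u : ℕ → A) (n i : ℕ) : word u i n ∈ LF u n :=
  mem_LF.2 ⟨length_word _ _ _, isFactor_word _ _ _⟩

noncomputable def vtx {A : Type*} [Fintype A] (u : ℕ → A) (n i : ℕ) : VS u n :=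
  ⟨cls (word u i n), Finset.mem_image_of_mem _ (word_mem_LF u n i)⟩

theorem exists_vtx {A : Type*} [Fintype A] {u : ℕ → A} {n : ℕ} (x : VS u n) :
    ∃ i, x = vtx u n i := by
  obtain ⟨x, hx⟩ := x
  obtain ⟨w, hw, rfl⟩ := Finset.mem_image.1 hx
  obtain ⟨h1, i, h2⟩ := mem_LF.1 hw
  refine ⟨i, ?_⟩
  apply Subtype.ext
  unfold OccursAt at h2
  rw [h1] at h2
  simp only [vtx, ← h2]

def RG {A : Type*} [Fintype A] (u : ℕ → A) (n : ℕ) : SimpleGraph (VS u n) where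
  Adj x y := x ≠ y ∧ ∃ i, s(x, y) = s(vtx u n i, vtx u n (i + 1))
  symm := ⟨by
    rintro x y ⟨h1, i, h2⟩
    exact ⟨h1.symm, i, by rw [Sym2.eq_swap, h2]⟩⟩
  loopless := ⟨by
    rintro x ⟨h1, _⟩
    exact h1 rfl⟩

theorem RG_adj {A : Type*} [Fintype A] {u : ℕ → A} {n i : ℕ}
    (h : vtx u n i ≠ vtx u n (i + 1)) : (RG u n).Adj (vtx u n i) (vtx u n (i + 1)) :=
  ⟨h, i, rfl⟩

theorem RG_connected {A : Type*} [Fintype A] (u : ℕ → A) (n : ℕ) : (RG u n).Connected := by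
  have h0 : ∀ i, (RG u n).Reachable (vtx u n 0) (vtx u n i) := by
    intro i
    induction i with
    | zero => exact SimpleGraph.Reachable.refl _
    | succ i ih =>
      by_cases h : vtx u n i = vtx u n (i + 1)
      · rw [← h]; exact ih
      · exact ih.trans (RG_adj h).reachable
  have : Nonempty (VS u n) := ⟨vtx u n 0⟩
  refine ⟨fun x y => ?_⟩
  obtain ⟨i, rfl⟩ := exists_vtx x
  obtain ⟨j, rfl⟩ := exists_vtx y
  exact (h0 i).symm.trans (h0 j)

/-- The pair of end classes of an edge. -/
noncomputable def Fm {A : Type*} (e : List A) : Sym2 (List A) := s(cls e.dropLast, cls e.tail)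

theorem Fm_reverse {A : Type*} (e : List A) : Fm e.reverse = Fm e := by
  unfold Fm
  rw [List.dropLast_reverse, List.tail_reverse, cls_reverse, cls_reverse, Sym2.eq_swap]

theorem Fm_cls {A : Type*} (e : List A) : Fm (cls e) = Fm e := by
  rcases cls_spec e with h | h <;> rw [h]
  exact Fm_reverse e

theorem Fm_word {A : Type*} (u : ℕ → A) (i n : ℕ) :
    Fm (word u i (n + 1)) = s(cls (word u i n), cls (word u (i + 1) n)) := by
  unfold Fm
  congr 2
  · rw [word_succ]; simp
  · rw [word_succ']; simp

theorem pal_ends {A : Type*} {e : List A} (h : e.reverse = e) : cls e.dropLast = cls e.tail := by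
  conv_rhs => rw [← h, List.tail_reverse, cls_reverse]

theorem RG_facts {A : Type*} [Fintype A] [Nonempty A] (u : ℕ → A)
    (hC : ∀ n : ℕ, complexity u n = (Fintype.card A - 1) * n + 1)
    (hrev : ClosedUnderReversal u)
    (hP : ∀ n, (PF u n).card + (PF u (n + 1)).card = Fintype.card A + 1) (n : ℕ) :
    (RG u n).IsAcyclic ∧
    (∀ i, cls (word u i n) = cls (word u (i + 1) n) →
      (word u i (n + 1)).reverse = word u i (n + 1)) ∧
    (∀ i j, (word u i (n + 1)).reverse ≠ word u i (n + 1) →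
      (word u j (n + 1)).reverse ≠ word u j (n + 1) →
      Fm (word u i (n + 1)) = Fm (word u j (n + 1)) →
      cls (word u i (n + 1)) = cls (word u j (n + 1))) := by
  have hLrev : ∀ m, ∀ w ∈ LF u m, w.reverse ∈ LF u m := by
    intro m w hw
    rw [mem_LF] at hw ⊢
    exact ⟨by simp [hw.1], hrev _ hw.2⟩
  set NP := (LF u (n + 1)).filter (fun w => ¬ w.reverse = w) with hNP
  have hV := card_cls (LF u n) (hLrev n)
  have hE := card_cls NP (by
    intro w hw
    rw [hNP, Finset.mem_filter] at hw ⊢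
    refine ⟨hLrev _ _ hw.1, ?_⟩
    rw [List.reverse_reverse]
    exact fun h => hw.2 h.symm)
  have hE0 : (NP.filter (fun w => w.reverse = w)).card = 0 := by
    rw [Finset.card_eq_zero, Finset.filter_eq_empty_iff]
    intro w hw
    exact (Finset.mem_filter.1 hw).2
  have hsplit := Finset.card_filter_add_card_filter_not (s := LF u (n + 1))
    (fun w : List A => w.reverse = w)
  have hA : 0 < Fintype.card A := Fintype.card_pos
  have hPn := hP n
  change 2 * (VS u n).card = (LF u n).card + (PF u n).card at hV
  change (PF u (n + 1)).card + NP.card = (LF u (n + 1)).card at hsplit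
  have hmul : (Fintype.card A - 1) * (n + 1) = (Fintype.card A - 1) * n + (Fintype.card A - 1) := by
    ring
  rw [card_LF, hC] at hV hsplit
  rw [hmul] at hsplit
  have hcount : (NP.image cls).card + 1 = (VS u n).card := by omega
  -- the edges
  have hconn := RG_connected u n
  have hle := hconn.card_vert_le_card_edgeSet_add_one
  have hVc : Nat.card (VS u n) = (VS u n).card := by simp
  have hEc : Nat.card (RG u n).edgeSet = ((RG u n).edgeFinset.image (Sym2.map Subtype.val)).card := by
    rw [Finset.card_image_of_injective _ (Sym2.map.injective Subtype.val_injective)]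
    rw [Nat.card_eq_fintype_card, SimpleGraph.edgeFinset_card]
  have hsub : (RG u n).edgeFinset.image (Sym2.map Subtype.val) ⊆ (NP.image cls).image Fm := by
    intro x hx
    obtain ⟨e, he, rfl⟩ := Finset.mem_image.1 hx
    rw [SimpleGraph.mem_edgeFinset] at he
    induction e using Sym2.ind with
    | _ x y =>
      rw [SimpleGraph.mem_edgeSet] at he
      obtain ⟨h1, i, h2⟩ := he
      rw [h2, Finset.mem_image]
      refine ⟨cls (word u i (n + 1)), Finset.mem_image_of_mem _ ?_, ?_⟩
      · rw [hNP, Finset.mem_filter]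
        refine ⟨word_mem_LF _ _ _, fun hp => h1 ?_⟩
        have h3 := pal_ends hp
        have h4 := Fm_word u i n
        unfold Fm at h4
        rw [h3] at h4
        have h5 : vtx u n i = vtx u n (i + 1) := by
          apply Subtype.ext
          simp only [vtx]
          rw [Sym2.eq_iff] at h4
          rcases h4 with h4 | h4
          · rw [← h4.1, ← h4.2]
          · rw [← h4.1, ← h4.2]
        rw [h5, Sym2.eq_iff] at h2
        rcases h2 with h2 | h2 <;> rw [h2.1, h2.2]
      · rw [Fm_cls, Fm_word]; rfl
  have hle2 := Finset.card_le_card hsub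
  have hle3 : ((NP.image cls).image Fm).card ≤ (NP.image cls).card := Finset.card_image_le
  have hinj :=
    Finset.card_image_iff.1 (le_antisymm hle3 (by omega))
  have heq := Finset.eq_of_subset_of_card_le hsub (by omega)
  refine ⟨?_, ?_, ?_⟩
  · exact (SimpleGraph.isTree_iff_connected_and_card.2 ⟨hconn, by omega⟩).isAcyclic
  · intro i hi
    by_contra hp
    have hmem : Fm (cls (word u i (n + 1))) ∈ (NP.image cls).image Fm := by
      refine Finset.mem_image_of_mem _ (Finset.mem_image_of_mem _ ?_)
      rw [hNP, Finset.mem_filter]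
      exact ⟨word_mem_LF _ _ _, hp⟩
    rw [← heq, Fm_cls, Fm_word, Finset.mem_image] at hmem
    obtain ⟨e, he, h⟩ := hmem
    rw [SimpleGraph.mem_edgeFinset] at he
    induction e using Sym2.ind with
    | _ x y =>
      rw [SimpleGraph.mem_edgeSet] at he
      apply he.ne
      rw [Sym2.map_mk, hi, Sym2.eq_iff] at h
      apply Subtype.ext
      rcases h with h | h <;> rw [h.1, h.2]
  · intro i j hi hj h
    rw [← Fm_cls, ← Fm_cls (word u j (n + 1))] at h
    refine hinj ?_ ?_ h
    · refine Finset.mem_coe.2 (Finset.mem_image_of_mem _ ?_)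
      rw [hNP, Finset.mem_filter]
      exact ⟨word_mem_LF _ _ _, hi⟩
    · refine Finset.mem_coe.2 (Finset.mem_image_of_mem _ ?_)
      rw [hNP, Finset.mem_filter]
      exact ⟨word_mem_LF _ _ _, hj⟩

theorem pal_cls_eq {A : Type*} {u : ℕ → A} {i n : ℕ}
    (h : (word u i (n + 1)).reverse = word u i (n + 1)) :
    cls (word u i n) = cls (word u (i + 1) n) := by
  have := pal_ends h
  rw [word_succ'] at this
  rw [List.tail_cons, ← word_succ', word_succ, List.dropLast_concat] at this
  exact this

theorem return_pal {A : Type*} [Fintype A] [Nonempty A] (u : ℕ → A)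
    (hC : ∀ n : ℕ, complexity u n = (Fintype.card A - 1) * n + 1)
    (hrev : ClosedUnderReversal u)
    (hP : ∀ n, (PF u n).card + (PF u (n + 1)).card = Fintype.card A + 1) (d : ℕ) :
    ∀ i n, cls (word u i n) = cls (word u (i + (d + 1)) n) →
      (∀ p, 0 < p → p < d + 1 → cls (word u (i + p) n) ≠ cls (word u i n)) →
      (word u i (n + (d + 1))).reverse = word u i (n + (d + 1)) := by
  induction d with
  | zero =>
    intro i n h _
    exact (RG_facts u hC hrev hP n).2.1 i h
  | succ d ih =>
    intro i n h hno
    obtain ⟨hac, hpal, hin⟩ := RG_facts u hC hrev hP n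
    have hxy : vtx u n i ≠ vtx u n (i + 1) := by
      intro e
      exact hno 1 (by omega) (by omega) (congrArg Subtype.val e).symm
    have hlast : vtx u n (i + (d + 1) + 1) = vtx u n i := Subtype.ext h.symm
    have hinterior : ∀ p, p ≤ d → vtx u n (i + 1 + p) ≠ vtx u n i := by
      intro p hp e
      refine hno (p + 1) (by omega) (by omega) ?_
      have := congrArg Subtype.val e
      simp only [vtx] at this
      rw [← this]
      congr 2
      omega
    have hadj := RG_adj hxy
    have hbr := SimpleGraph.isAcyclic_iff_forall_adj_isBridge.1 hac hadj
    rw [SimpleGraph.isBridge_iff] at hbr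
    have hreach : ∀ p, p ≤ d → ((RG u n).deleteEdges {s(vtx u n i, vtx u n (i + 1))}).Reachable
        (vtx u n (i + 1)) (vtx u n (i + 1 + p)) := by
      intro p
      induction p with
      | zero => intro _; exact SimpleGraph.Reachable.refl _
      | succ p ihp =>
        intro hp
        have h1 := ihp (by omega)
        by_cases e : vtx u n (i + 1 + p) = vtx u n (i + 1 + p + 1)
        · rw [← add_assoc, ← e]; exact h1
        · refine h1.trans (SimpleGraph.Adj.reachable ?_)
          rw [SimpleGraph.deleteEdges_adj]
          refine ⟨RG_adj e, ?_⟩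
          rw [Set.mem_singleton_iff, Sym2.eq_iff]
          rintro (⟨h2, _⟩ | ⟨_, h2⟩)
          · exact hinterior p (by omega) h2
          · exact hinterior (p + 1) hp h2
    have hyz : vtx u n (i + 1 + d) = vtx u n (i + 1) := by
      by_contra hne
      apply hbr
      refine ((hreach d le_rfl).trans (SimpleGraph.Adj.reachable ?_)).symm
      rw [SimpleGraph.deleteEdges_adj]
      have hzx : vtx u n (i + 1 + d + 1) = vtx u n i := by
        rw [← hlast]; congr 1; omega
      refine ⟨?_, ?_⟩
      · rw [← hzx]
        apply RG_adj
        rw [hzx]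
        exact hinterior d le_rfl
      · rw [Set.mem_singleton_iff, Sym2.eq_iff]
        rintro (⟨h2, _⟩ | ⟨h2, _⟩)
        · exact hinterior d le_rfl h2
        · exact hne h2
    have hyz' : cls (word u (i + (d + 1)) n) = cls (word u (i + 1) n) := by
      have := congrArg Subtype.val hyz
      simp only [vtx] at this
      rw [← this]; congr 2; omega
    have hlast' : cls (word u (i + (d + 1) + 1) n) = cls (word u i n) := h.symm
    have hne : cls (word u (i + 1) n) ≠ cls (word u i n) := hno 1 (by omega) (by omega)
    have hcls : cls (word u i (n + 1)) = cls (word u (i + (d + 1)) (n + 1)) := by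
      apply hin
      · intro hp; exact hne (pal_cls_eq hp).symm
      · intro hp
        have := pal_cls_eq hp
        rw [hlast', hyz'] at this
        exact hne this
      · rw [Fm_word, Fm_word, hyz', hlast', Sym2.eq_swap]
    have := ih i (n + 1) hcls ?_
    · rw [show n + (d + 1 + 1) = n + 1 + (d + 1) by omega]; exact this
    · intro p hp0 hp1 e
      rw [cls_eq_iff] at e
      rcases e with e | e
      · rw [word_succ, word_succ] at e
        refine hno p hp0 (by omega) ?_
        rw [(List.append_inj' e rfl).1]
      · rw [word_succ', word_succ, List.reverse_append] at e
        simp only [List.reverse_cons, List.reverse_nil, List.nil_append, List.cons_append,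
          List.cons.injEq] at e
        refine hno (p + 1) (by omega) (by omega) ?_
        rw [← add_assoc, e.2, cls_reverse]

/-! Extension graphs are connected -/

theorem conn_count {A : Type*} (L R : Finset A) (B : Finset (A × A))
    (hB : ∀ p ∈ B, p.1 ∈ L ∧ p.2 ∈ R) (hL : L.Nonempty)
    (h : ∀ p q : A → Prop, (∀ e ∈ B, (p e.1 ↔ q e.2)) → ∀ a ∈ L, p a →
      (∀ a' ∈ L, p a') ∧ (∀ b ∈ R, q b)) :
    L.card + R.card ≤ B.card + 1 := by
  let f : B → Sym2 (L ⊕ R) := fun e =>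
    s(Sum.inl ⟨e.1.1, (hB e.1 e.2).1⟩, Sum.inr ⟨e.1.2, (hB e.1 e.2).2⟩)
  let G : SimpleGraph (L ⊕ R) := SimpleGraph.fromEdgeSet (Set.range f)
  obtain ⟨a, ha⟩ := hL
  have hadj : ∀ e (he : e ∈ B), G.Adj (Sum.inl ⟨e.1, (hB e he).1⟩) (Sum.inr ⟨e.2, (hB e he).2⟩) := by
    intro e he
    rw [SimpleGraph.fromEdgeSet_adj]
    exact ⟨⟨⟨e, he⟩, rfl⟩, by simp⟩
  have hreach : ∀ x, G.Reachable (Sum.inl ⟨a, ha⟩) x := by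
    have := h (fun a' => ∃ h' : a' ∈ L, G.Reachable (Sum.inl ⟨a, ha⟩) (Sum.inl ⟨a', h'⟩))
      (fun b => ∃ h' : b ∈ R, G.Reachable (Sum.inl ⟨a, ha⟩) (Sum.inr ⟨b, h'⟩)) ?_ a ha
      ⟨ha, SimpleGraph.Reachable.refl _⟩
    · rintro (⟨x, hx⟩ | ⟨x, hx⟩)
      · exact (this.1 x hx).2
      · exact (this.2 x hx).2
    · intro e he
      constructor
      · rintro ⟨h1, h2⟩
        exact ⟨(hB e he).2, h2.trans (hadj e he).reachable⟩
      · rintro ⟨h1, h2⟩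
        exact ⟨(hB e he).1, h2.trans (hadj e he).reachable.symm⟩
  have : Nonempty (L ⊕ R) := ⟨Sum.inl ⟨a, ha⟩⟩
  have hconn : G.Connected := ⟨fun x y => (hreach x).symm.trans (hreach y)⟩
  have hle := hconn.card_vert_le_card_edgeSet_add_one
  have h1 : Nat.card (L ⊕ R) = L.card + R.card := by simp
  have h2 : Nat.card G.edgeSet ≤ B.card := by
    have e : G.edgeSet ⊆ Set.range f := by
      rw [SimpleGraph.edgeSet_fromEdgeSet]; exact Set.sdiff_subset
    calc Nat.card G.edgeSet ≤ Nat.card (Set.range f) :=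
          Nat.card_mono (Set.finite_range f) e
      _ ≤ Nat.card B := Finite.card_range_le f
      _ = B.card := by simp
  omega

theorem propagate (S : ℕ → Prop) (D : ℕ → Prop)
    (h : ∀ i d, S i → S (i + (d + 1)) → (∀ p, 0 < p → p < d + 1 → ¬ S (i + p)) →
      (D i ↔ D (i + (d + 1)))) :
    ∀ i j, S i → S j → (D i ↔ D j) := by
  have key : ∀ d i, S i → S (i + d) → (D i ↔ D (i + d)) := by
    intro d
    induction d using Nat.strong_induction_on with
    | _ d ih =>
      intro i hi hd
      rcases d with _ | d
      · simp
      · by_cases hex : ∃ p, 0 < p ∧ p < d + 1 ∧ S (i + p)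
        · obtain ⟨p, hp0, hp1, hp⟩ := hex
          have h1 := ih p hp1 i hi hp
          have h2 := ih (d + 1 - p) (by omega) (i + p) hp
          rw [show i + p + (d + 1 - p) = i + (d + 1) by omega] at h2
          exact h1.trans (h2 hd)
        · push Not at hex
          exact h i d hi hd hex
  intro i j hi hj
  rcases le_total i j with hij | hij
  · obtain ⟨d, rfl⟩ := Nat.exists_eq_add_of_le hij
    exact key d i hi hj
  · obtain ⟨d, rfl⟩ := Nat.exists_eq_add_of_le hij
    exact (key d j hj hi).symm

theorem pal_symm {A : Type*} {u : ℕ → A} {i n d : ℕ}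
    (h : (word u i (n + (d + 1))).reverse = word u i (n + (d + 1))) :
    u (i + n) = u (i + d) ∧ (word u (i + (d + 1)) n) = (word u i n).reverse := by
  constructor
  · have h1 : n < (word u i (n + (d + 1))).length := by rw [length_word]; omega
    have h2 : (word u i (n + (d + 1)))[n] = u (i + n) := getElem_word _ _ _ _ _
    have h3 : n < (word u i (n + (d + 1))).reverse.length := by simpa using h1
    have h4 : (word u i (n + (d + 1))).reverse[n] = (word u i (n + (d + 1)))[n] := by
      simp only [h]
    rw [List.getElem_reverse, getElem_word, getElem_word, length_word] at h4
    rw [← h4]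
    congr 2
    omega
  · have h2 : word u i (n + (d + 1)) = word u i (d + 1) ++ word u (i + (d + 1)) n := by
      rw [add_comm, word_add]
    have h3 : word u i (n + (d + 1)) = word u i n ++ word u (i + n) (d + 1) := word_add _ _ _ _
    have h4 := h.symm
    rw [h3, List.reverse_append, ← h3, h2] at h4
    exact (List.append_inj' h4 (by simp [length_word])).2

/-- Positions `i` such that `w` or its reversal occurs at `i + 1`. -/
def Pos {A : Type*} (u : ℕ → A) (w : List A) (i : ℕ) : Prop :=
  cls (word u (i + 1) w.length) = cls w

theorem Pos_iff {A : Type*} {u : ℕ → A} {w : List A} {i : ℕ} : Pos u w i ↔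
    word u (i + 1) w.length = w ∨ word u (i + 1) w.length = w.reverse := cls_eq_iff

theorem pos_left {A : Type*} {u : ℕ → A} {w : List A} {a : A} (h : IsFactor u (a :: w)) :
    ∃ i, word u (i + 1) w.length = w ∧ u i = a := by
  obtain ⟨i, hi⟩ := h
  rw [occ_cons] at hi
  exact ⟨i, hi.2.symm, hi.1.symm⟩

theorem pos_right {A : Type*} {u : ℕ → A} (hur : UniformlyRecurrent u) {w : List A} {b : A}
    (h : IsFactor u (w ++ [b])) :
    ∃ i, word u (i + 1) w.length = w ∧ u (i + 1 + w.length) = b := by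
  obtain ⟨j, hj, ho⟩ := occ_ge hur h 1
  obtain ⟨i, rfl⟩ := Nat.exists_eq_add_of_le hj
  rw [occ_append, occ_singleton] at ho
  exact ⟨i, by rw [add_comm i 1]; exact ho.1.symm, by rw [add_comm i 1]; exact ho.2.symm⟩

theorem ext_factor {A : Type*} (u : ℕ → A) (i n : ℕ) :
    IsFactor u (u i :: (word u (i + 1) n ++ [u (i + 1 + n)])) := by
  have := isFactor_word u i (n + 1 + 1)
  rw [word_succ', word_succ] at this
  exact this

theorem bilateral_nonneg {A : Type*} [Fintype A] [Nonempty A] (u : ℕ → A)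
    (hall : AllLettersOccur u)
    (hur : UniformlyRecurrent u)
    (hC : ∀ n : ℕ, complexity u n = (Fintype.card A - 1) * n + 1)
    (hPE : ∀ w : List A, IsFactor u w → w.reverse = w →
      Set.ncard (Pext u w) = 1) (w : List A) (hw : IsFactor u w) :
    (lx u w).card + (rx u w).card ≤ (bx u w).card + 1 := by
  have hrev := closed_rev hur hPE
  have hP := card_PF_sum hall hPE
  have hnext : ∀ i d, Pos u w i → Pos u w (i + (d + 1)) →
      (∀ p, 0 < p → p < d + 1 → ¬ Pos u w (i + p)) →
      u (i + 1 + w.length) = u (i + (d + 1)) ∧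
        word u (i + (d + 1) + 1) w.length = (word u (i + 1) w.length).reverse := by
    intro i d h1 h2 h3
    unfold Pos at h1 h2 h3
    have h4 := return_pal u hC hrev hP d (i + 1) w.length ?_ ?_
    · have := pal_symm h4
      rw [show i + (d + 1) = i + 1 + d by omega, show i + 1 + d + 1 = i + 1 + (d + 1) by omega]
      exact this
    · rw [h1, show i + 1 + (d + 1) = i + (d + 1) + 1 by omega, h2]
    · intro p hp0 hp1 e
      rw [h1, show i + 1 + p = i + p + 1 by omega] at e
      exact h3 p hp0 hp1 e
  apply conn_count
  · intro p hp
    rw [mem_bx] at hp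
    rw [mem_lx, mem_rx]
    exact ⟨factor_infix ⟨[], [p.2], by simp⟩ hp, factor_infix ⟨[p.1], [], by simp⟩ hp⟩
  · obtain ⟨j, hj, ho⟩ := occ_ge hur hw 1
    obtain ⟨i, rfl⟩ := Nat.exists_eq_add_of_le hj
    refine ⟨u i, mem_lx.2 ⟨i, (occ_cons _ _ _ _).2 ⟨rfl, ?_⟩⟩⟩
    rw [add_comm]; exact ho
  · intro p q hpq a ha hpa
    have hedge : ∀ i, word u (i + 1) w.length = w → (p (u i) ↔ q (u (i + 1 + w.length))) := by
      intro i hi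
      have := ext_factor u i w.length
      rw [hi] at this
      exact hpq (u i, u (i + 1 + w.length)) (mem_bx.2 this)
    have hedge' : ∀ i, word u (i + 1) w.length = w.reverse →
        (p (u (i + 1 + w.length)) ↔ q (u i)) := by
      intro i hi
      have := hrev _ (ext_factor u i w.length)
      rw [hi] at this
      simp only [List.reverse_cons, List.reverse_append, List.reverse_nil, List.nil_append,
        List.reverse_reverse, List.cons_append] at this
      exact hpq (u (i + 1 + w.length), u i) (mem_bx.2 this)
    obtain ⟨i0, hi0, hia⟩ := pos_left (mem_lx.1 ha)
    by_cases hpal : w.reverse = w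
    · -- palindromic case
      have hocc : ∀ i, Pos u w i → word u (i + 1) w.length = w := by
        intro i hi
        rw [Pos_iff, hpal, or_self] at hi
        exact hi
      have hD := propagate (Pos u w) (fun i => (p (u i) ↔ q (u i))) (by
        intro i d h1 h2 h3
        have h4 := (hnext i d h1 h2 h3).1
        have h5 := hedge i (hocc i h1)
        have h6 := hedge' i (by rw [hpal]; exact hocc i h1)
        rw [h4] at h5 h6
        show (p (u i) ↔ q (u i)) ↔ (p (u (i + (d + 1))) ↔ q (u (i + (d + 1))))
        tauto)
      obtain ⟨c, hc, _⟩ := pal_unique hPE hw hpal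
      obtain ⟨l, hl⟩ := hc
      rw [occ_cons, occ_append, occ_singleton] at hl
      have hlp : Pos u w l := Pos_iff.2 (Or.inl hl.2.1.symm)
      have hDl : p (u l) ↔ q (u l) := by
        have := hedge l hl.2.1.symm
        rwa [← hl.2.2, hl.1] at this
      have hDall : ∀ i, Pos u w i → (p (u i) ↔ q (u i)) := fun i hi => (hD l i hlp hi).1 hDl
      have hp := propagate (Pos u w) (fun i => p (u i)) (by
        intro i d h1 h2 h3
        have h4 := (hnext i d h1 h2 h3).1
        have h5 := hedge i (hocc i h1)
        have h6 := hDall _ h2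
        rw [h4] at h5
        show p (u i) ↔ p (u (i + (d + 1)))
        tauto)
      have hi0p : Pos u w i0 := Pos_iff.2 (Or.inl hi0)
      have hpall : ∀ i, Pos u w i → p (u i) := fun i hi => (hp i0 i hi0p hi).1 (hia ▸ hpa)
      constructor
      · intro a' ha'
        obtain ⟨i, h1, h2⟩ := pos_left (mem_lx.1 ha')
        rw [← h2]
        exact hpall i (Pos_iff.2 (Or.inl h1))
      · intro b hb
        obtain ⟨i, h1, h2⟩ := pos_right hur (mem_rx.1 hb)
        rw [← h2]
        exact (hedge i h1).1 (hpall i (Pos_iff.2 (Or.inl h1)))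
    · -- the other case
      have hc := propagate (Pos u w)
        (fun i => (word u (i + 1) w.length = w ∧ p (u i)) ∨
          (word u (i + 1) w.length = w.reverse ∧ q (u i))) (by
        intro i d h1 h2 h3
        obtain ⟨h4, h5⟩ := hnext i d h1 h2 h3
        have h6 := hedge i
        have h7 := hedge' i
        rw [h4] at h6 h7
        have hpal' : w ≠ w.reverse := fun e => hpal e.symm
        rcases Pos_iff.1 h1 with h8 | h8
        · rw [h8] at h5
          have h9 := h6 h8
          simp only [h8, h5, hpal, hpal']
          simpa using h9
        · rw [h8, List.reverse_reverse] at h5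
          have h9 := h7 h8
          simp only [h8, h5, hpal, hpal']
          simpa using h9.symm)
      have hi0p : Pos u w i0 := Pos_iff.2 (Or.inl hi0)
      have hpall : ∀ i, word u (i + 1) w.length = w → p (u i) := by
        intro i hi
        rcases (hc i0 i hi0p (Pos_iff.2 (Or.inl hi))).1 (Or.inl ⟨hi0, hia ▸ hpa⟩) with h | h
        · exact h.2
        · rw [hi] at h
          exact absurd h.1.symm hpal
      constructor
      · intro a' ha'
        obtain ⟨i, h1, h2⟩ := pos_left (mem_lx.1 ha')
        rw [← h2]
        exact hpall i h1
      · intro b hb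
        obtain ⟨i, h1, h2⟩ := pos_right hur (mem_rx.1 hb)
        rw [← h2]
        exact (hedge i h1).1 (hpall i h1)

end PEProof

/-- For a uniformly recurrent infinite word over a `k`-letter
alphabet with `C(n) = (k−1)n + 1` for all `n`: Property PE implies Property
R. -/
theorem stmt17 {A : Type*} [Fintype A] (u : ℕ → A)
    (hall : AllLettersOccur u)
    (hur : UniformlyRecurrent u)
    (hC : ∀ n : ℕ, complexity u n = (Fintype.card A - 1) * n + 1)
    (hPE : ∀ w : List A, IsFactor u w → w.reverse = w →
      Set.ncard (Pext u w) = 1) :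
    ∀ w : List A, IsFactor u w →
      Set.ncard (returnWords u w) = Fintype.card A := by
  have : Nonempty A := ⟨u 0⟩
  intro w hw
  exact PEProof.ncard_returnWords u hur hC
    (PEProof.neutral_of_nonneg u hC (PEProof.bilateral_nonneg u hall hur hC hPE)) w hw
end

section
/- Let u be a uniformly recurrent infinite word over a finite alphabet A with k = #A letters, such that every palindromic factor of u has exactly one palindromic extension (Property PE). Then u is rich in palindromes if and only if every factor of u has exactly k return words (Property R). -/
open List

namespace PR

variable {A : Type*}

lemma word_length (u : ℕ → A) (i n : ℕ) : (word u i n).length = n := by simp [word]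

lemma word_getElem (u : ℕ → A) (i n p : ℕ) (h : p < (word u i n).length) :
    (word u i n)[p] = u (i + p) := by simp [word]

lemma word_eq_iff (u : ℕ → A) (i j n : ℕ) :
    word u i n = word u j n ↔ ∀ p < n, u (i + p) = u (j + p) := by
  constructor
  · intro h p hp
    have h1 := word_getElem u i n p (by simpa [word_length] using hp)
    have h2 := word_getElem u j n p (by simpa [word_length] using hp)
    rw [← h1, ← h2]; simp only [h]
  · intro h
    apply List.ext_getElem
    · simp [word_length]
    · intro p h1 h2
      rw [word_getElem, word_getElem]
      exact h p (by simpa [word_length] using h1)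

lemma word_rev_iff (u : ℕ → A) (i j n : ℕ) :
    (word u i n).reverse = word u j n ↔ ∀ p < n, u (i + (n - 1 - p)) = u (j + p) := by
  constructor
  · intro h p hp
    have h1 := word_getElem u i n (n - 1 - p) (by rw [word_length]; omega)
    have h2 := word_getElem u j n p (by simpa [word_length] using hp)
    rw [← h1, ← h2]; simp only [← h]
    rw [List.getElem_reverse]; simp only [word_length]
  · intro h
    apply List.ext_getElem
    · simp [word_length]
    · intro p h1 h2
      rw [word_getElem, List.getElem_reverse, word_getElem]
      simp only [word_length] at h2 ⊢
      exact h p h2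

/-- Subwords of equal words. -/
lemma word_sub {u : ℕ → A} {i j n : ℕ} (h : word u i n = word u j n) {p m : ℕ}
    (hp : p + m ≤ n) : word u (i + p) m = word u (j + p) m := by
  rw [word_eq_iff] at h ⊢
  intro q hq
  have := h (p + q) (by omega)
  simpa [add_assoc] using this

/-- Mirrored subwords. -/
lemma word_mirror {u : ℕ → A} {i j n : ℕ} (h : (word u i n).reverse = word u j n) {p q m : ℕ}
    (hp : p + m + q = n) : (word u (i + p) m).reverse = word u (j + q) m := by
  rw [word_rev_iff] at h ⊢
  intro s hs
  have := h (q + s) (by omega)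
  rw [show i + (n - 1 - (q + s)) = i + p + (m - 1 - s) by omega,
    show j + (q + s) = j + q + s by omega] at this
  exact this

lemma word_append (u : ℕ → A) (i m n : ℕ) :
    word u i (m + n) = word u i m ++ word u (i + m) n := by
  simp [word, List.range_add, add_assoc]

lemma word_zero (u : ℕ → A) (i : ℕ) : word u i 0 = [] := by simp [word]

lemma occ_iff {u : ℕ → A} {w : List A} {i : ℕ} : OccursAt u w i ↔ word u i w.length = w :=
  eq_comm

lemma infix_word {u : ℕ → A} {v : List A} {i n : ℕ} :
    v <:+: word u i n ↔ ∃ p, p + v.length ≤ n ∧ word u (i + p) v.length = v := by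
  constructor
  · rintro ⟨s, t, h⟩
    have hl := congrArg List.length h
    simp [word_length] at hl
    refine ⟨s.length, by omega, ?_⟩
    have h2 : n = s.length + (v.length + t.length) := by omega
    rw [h2, word_append, word_append, List.append_assoc] at h
    have h3 := (List.append_inj h (by simp [word_length])).2
    exact (List.append_inj h3 (by simp [word_length])).1.symm
  · rintro ⟨p, hp, h⟩
    obtain ⟨t, rfl⟩ := Nat.exists_eq_add_of_le hp
    rw [add_assoc, word_append, word_append, h]
    exact ⟨_, _, by rw [List.append_assoc]⟩

lemma factor_of_sub {u : ℕ → A} {v w : List A} (h : IsFactor u w) (hv : v <:+: w) :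
    IsFactor u v := by
  obtain ⟨i, hi⟩ := h
  rw [hi, infix_word] at hv
  obtain ⟨p, _, h⟩ := hv
  exact ⟨i + p, occ_iff.2 h⟩

lemma factor_word (u : ℕ → A) (i n : ℕ) : IsFactor u (word u i n) :=
  ⟨i, by rw [occ_iff, word_length]⟩

lemma infix_rev {v w : List A} (h : v <:+: w) : v.reverse <:+: w.reverse := by
  obtain ⟨s, t, rfl⟩ := h
  exact ⟨t.reverse, s.reverse, by simp⟩

lemma infix_finite (w : List A) : {v : List A | v <:+: w ∧ v.reverse = v}.Finite := by
  apply Set.Finite.subset (s := {v | v ∈ w.sublists})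
  · exact List.finite_toSet _
  · rintro v ⟨hv, _⟩
    simp only [Set.mem_ofPred_eq, List.mem_sublists]
    exact hv.sublist

/-- Occurrence of `w` or of its reversal. -/
def Occ (u : ℕ → A) (w : List A) (i : ℕ) : Prop :=
  word u i w.length = w ∨ word u i w.length = w.reverse

lemma Occ.rev {u : ℕ → A} {w : List A} {i j : ℕ} (h : Occ u w i)
    (hj : (word u i w.length).reverse = word u j w.length) : Occ u w j := by
  unfold Occ at *
  rw [← hj]
  rcases h with h | h <;> rw [h] <;> simp

lemma Occ.congr {u : ℕ → A} {w : List A} {i j : ℕ} (h : Occ u w i)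
    (hj : word u i w.length = word u j w.length) : Occ u w j := by
  unfold Occ at *
  rw [← hj]; exact h

lemma Occ.eq_or {u : ℕ → A} {w : List A} {i j : ℕ} (hi : Occ u w i) (hj : Occ u w j) :
    word u j w.length = word u i w.length ∨
      (word u j w.length).reverse = word u i w.length := by
  rcases hi with h | h <;> rcases hj with h' | h' <;> rw [h, h'] <;> simp

/-- Consecutive occurrences of `w` or its reversal. -/
def Gap (u : ℕ → A) (w : List A) (i j : ℕ) : Prop :=
  Occ u w i ∧ Occ u w j ∧ i < j ∧ ∀ l, i < l → l < j → ¬ Occ u w l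

lemma rich_gap {u : ℕ → A} (hr : Rich u) {w : List A} {i j : ℕ} (h : Gap u w i j) :
    (word u i (j - i + w.length)).reverse = word u i (j - i + w.length) := by
  obtain ⟨hi, hj, hij, hbet⟩ := h
  obtain ⟨L, hL⟩ : ∃ L, j - i + w.length = L + 1 := ⟨j - i + w.length - 1, by omega⟩
  rw [hL]
  have h1 := hr _ (factor_word u i (L + 1))
  have h2 := hr _ (factor_word u i L)
  rw [word_length] at h1 h2
  have hns : ¬ {v : List A | v <:+: word u i (L+1) ∧ v.reverse = v} ⊆
      {v : List A | v <:+: word u i L ∧ v.reverse = v} := by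
    intro hs
    have := Set.ncard_le_ncard hs (infix_finite _)
    unfold palCount at h1 h2
    omega
  rw [Set.not_subset] at hns
  obtain ⟨v, ⟨hv, hvp⟩, hn⟩ := hns
  have hn' : ¬ v <:+: word u i L := fun h => hn ⟨h, hvp⟩
  rw [infix_word] at hv hn'
  push Not at hn'
  obtain ⟨p, hp, hv⟩ := hv
  have hpL : p + v.length = L + 1 := by
    by_contra hc
    exact hn' p (by omega) hv
  by_cases hlen : v.length ≤ w.length
  · exfalso
    rcases hi.eq_or hj with e | e
    · have := word_sub e (p := w.length - v.length) (m := v.length) (by omega)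
      rw [show j + (w.length - v.length) = i + p by omega, hv] at this
      exact hn' _ (by omega) this.symm
    · have := word_mirror e (p := w.length - v.length) (m := v.length) (q := 0) (by omega)
      rw [show j + (w.length - v.length) = i + p by omega, hv, hvp] at this
      exact hn' _ (by omega) this.symm
  · have hvr : (word u (i + p) v.length).reverse = word u (i + p) v.length := by rw [hv, hvp]
    have := word_mirror hvr (p := v.length - w.length) (m := w.length) (q := 0) (by omega)
    rw [show i + p + (v.length - w.length) = j by omega] at this
    have ho := hj.rev this
    have hp0 : p = 0 := by
      by_contra hc
      exact hbet _ (by omega) (by omega) ho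
    subst hp0
    rw [show L + 1 = v.length by omega]
    exact hvr

lemma last_before (P : ℕ → Prop) (q p : ℕ) (hq : P q) (hqp : q < p) :
    ∃ q', q' < p ∧ P q' ∧ ∀ l, q' < l → l < p → ¬ P l := by
  classical
  refine ⟨Nat.findGreatest P (p - 1), ?_, ?_, ?_⟩
  · have := Nat.findGreatest_le (P := P) (p - 1)
    omega
  · exact Nat.findGreatest_spec (m := q) (by omega) hq
  · intro l h1 h2
    exact Nat.findGreatest_is_greatest h1 (by omega)

lemma rich_of_ret {u : ℕ → A}
    (h : ∀ w : List A, w.reverse = w → ∀ i j, SuccOccurrences u w i j →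
      (word u i (j - i + w.length)).reverse = word u i (j - i + w.length)) : Rich u := by
  classical
  have key : ∀ n i, palCount (word u i n) = n + 1 := by
    intro n i
    induction n with
    | zero =>
      unfold palCount
      rw [word_zero]
      have : {v : List A | v <:+: [] ∧ v.reverse = v} = {[]} := by
        ext v; simp
        rintro rfl; rfl
      rw [this]; simp
    | succ n ih =>
      have hex : ∃ p, p ≤ n + 1 ∧
          (word u (i + p) (n + 1 - p)).reverse = word u (i + p) (n + 1 - p) :=
        ⟨n + 1, le_rfl, by simp [word_zero]⟩
      obtain ⟨hp1, hp2⟩ := Nat.find_spec hex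
      have hmin := fun q hq => Nat.find_min hex (m := q) hq
      generalize Nat.find hex = p at hp1 hp2 hmin
      set s := word u (i + p) (n + 1 - p) with hs
      have hsl : s.length = n + 1 - p := word_length _ _ _
      have hnot : s ∉ {v : List A | v <:+: word u i n ∧ v.reverse = v} := by
        rintro ⟨hsi, -⟩
        rw [infix_word] at hsi
        obtain ⟨q, hq1, hq2⟩ := hsi
        obtain ⟨q', h1, h2, h3⟩ := last_before (fun q => word u (i + q) s.length = s) q p hq2
          (by omega)
        have hso : SuccOccurrences u s (i + q') (i + p) := by
          refine ⟨occ_iff.2 h2, occ_iff.2 (by rw [hsl]), by omega, ?_⟩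
          intro l hl1 hl2 ho
          refine h3 (l - i) (by omega) (by omega) ?_
          rw [show i + (l - i) = l by omega]
          exact occ_iff.1 ho
        have := h s hp2 _ _ hso
        rw [show i + p - (i + q') + s.length = n + 1 - q' by omega] at this
        exact hmin q' h1 ⟨by omega, this⟩
      have hins : {v : List A | v <:+: word u i (n + 1) ∧ v.reverse = v} =
          insert s {v : List A | v <:+: word u i n ∧ v.reverse = v} := by
        ext v
        simp only [Set.mem_insert_iff, Set.mem_ofPred_eq]
        constructor
        · rintro ⟨hv, hvp⟩
          by_cases hvi : v <:+: word u i n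
          · exact Or.inr ⟨hvi, hvp⟩
          left
          have hvi' := hvi
          rw [infix_word] at hv hvi
          push Not at hvi
          obtain ⟨r, hr1, hr2⟩ := hv
          have hrl : r + v.length = n + 1 := by
            by_contra hc
            exact hvi r (by omega) hr2
          have hvl : v.length = n + 1 - r := by omega
          have hpr : p ≤ r := by
            by_contra hc
            refine hmin r (by omega) ⟨by omega, ?_⟩
            rw [← hvl, hr2, hvp]
          by_cases hpr' : p = r
          · subst hpr'
            rw [hs, ← hvl, hr2]
          exfalso
          have := word_mirror hp2 (p := r - p) (m := v.length) (q := 0) (by omega)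
          rw [show i + p + (r - p) = i + r by omega, hr2, hvp] at this
          exact hvi p (by omega) this.symm
        · rintro (rfl | ⟨hv, hvp⟩)
          · refine ⟨?_, hp2⟩
            rw [infix_word]
            exact ⟨p, by omega, by rw [hsl]⟩
          · refine ⟨hv.trans ?_, hvp⟩
            rw [word_append]
            exact (List.prefix_append _ _).isInfix
      unfold palCount at ih ⊢
      rw [hins, Set.ncard_insert_of_notMem hnot (infix_finite _), ih]
  rintro w ⟨i, hi⟩
  rw [hi, key, word_length]


/-- Property PE. -/
def PE (u : ℕ → A) : Prop :=
  ∀ w : List A, IsFactor u w → w.reverse = w → Set.ncard (Pext u w) = 1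

lemma PE.ex {u : ℕ → A} (h : PE u) {w : List A} (hw : IsFactor u w) (hp : w.reverse = w) :
    ∃ a, IsFactor u (a :: (w ++ [a])) := by
  obtain ⟨v, hv⟩ := Set.ncard_eq_one.1 (h w hw hp)
  have : v ∈ Pext u w := by rw [hv]; rfl
  obtain ⟨a, rfl, ha⟩ := this
  exact ⟨a, ha⟩

lemma PE.unique {u : ℕ → A} (h : PE u) {w : List A} (hw : IsFactor u w) (hp : w.reverse = w)
    {a b : A} (ha : IsFactor u (a :: (w ++ [a]))) (hb : IsFactor u (b :: (w ++ [b]))) :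
    a = b := by
  obtain ⟨v, hv⟩ := Set.ncard_eq_one.1 (h w hw hp)
  have h1 : a :: (w ++ [a]) ∈ Pext u w := ⟨a, rfl, ha⟩
  have h2 : b :: (w ++ [b]) ∈ Pext u w := ⟨b, rfl, hb⟩
  rw [hv] at h1 h2
  have := h1.trans h2.symm
  exact (List.cons.inj this).1

open Classical in
/-- A palindromic extension of a word (or the word itself if there is none). -/
noncomputable def pext (u : ℕ → A) (w : List A) : List A :=
  if h : ∃ a, IsFactor u (a :: (w ++ [a])) then h.choose :: (w ++ [h.choose]) else w

/-- The chain of palindromes with a given centre. -/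
noncomputable def chain (u : ℕ → A) (c : Option A) : ℕ → List A
  | 0 => c.toList
  | m + 1 => pext u (chain u c m)

lemma chain_spec {u : ℕ → A} (hall : AllLettersOccur u) (h : PE u) (c : Option A) (m : ℕ) :
    IsFactor u (chain u c m) ∧ (chain u c m).reverse = chain u c m := by
  induction m with
  | zero =>
    cases c with
    | none => exact ⟨⟨0, by simp [chain, OccursAt, word]⟩, rfl⟩
    | some a =>
      obtain ⟨i, hi⟩ := hall a
      exact ⟨⟨i, by simp [chain, OccursAt, word, hi]⟩, rfl⟩
  | succ m ih =>
    have hex := h.ex ih.1 ih.2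
    simp only [chain, pext, dif_pos hex]
    refine ⟨hex.choose_spec, ?_⟩
    simp [ih.2]

lemma chain_succ {u : ℕ → A} (hall : AllLettersOccur u) (h : PE u) (c : Option A) (m : ℕ) :
    ∃ a, chain u c (m + 1) = a :: (chain u c m ++ [a]) := by
  have ih := chain_spec hall h c m
  have hex := h.ex ih.1 ih.2
  exact ⟨hex.choose, by simp only [chain, pext, dif_pos hex]⟩

lemma chain_length {u : ℕ → A} (hall : AllLettersOccur u) (h : PE u) (c : Option A) (m : ℕ) :
    (chain u c m).length = c.toList.length + 2 * m := by
  induction m with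
  | zero => rfl
  | succ m ih =>
    obtain ⟨a, ha⟩ := chain_succ hall h c m
    rw [ha]; simp [ih]; omega

lemma chain_inj {u : ℕ → A} (hall : AllLettersOccur u) (h : PE u) (c c' : Option A) (m m' : ℕ)
    (he : chain u c m = chain u c' m') : c = c' ∧ m = m' := by
  induction m generalizing m' with
  | zero =>
    have hl := congrArg List.length he
    rw [chain_length hall h, chain_length hall h] at hl
    cases m' with
    | zero =>
      simp only [chain] at he
      cases c <;> cases c' <;> simp_all
    | succ m' => cases c <;> cases c' <;> simp at hl <;> omega
  | succ m ih =>
    cases m' with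
    | zero =>
      have hl := congrArg List.length he
      rw [chain_length hall h, chain_length hall h] at hl
      cases c <;> cases c' <;> simp at hl <;> omega
    | succ m' =>
      obtain ⟨a, ha⟩ := chain_succ hall h c m
      obtain ⟨b, hb⟩ := chain_succ hall h c' m'
      rw [ha, hb] at he
      have h1 := (List.cons.inj he).2
      have h2 := (List.append_inj' h1 rfl).1
      have := ih m' h2
      exact ⟨this.1, by omega⟩

lemma chain_complete {u : ℕ → A} (hall : AllLettersOccur u) (h : PE u) (v : List A)
    (hv : IsFactor u v) (hp : v.reverse = v) : ∃ c m, v = chain u c m := by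
  have hp' := List.Palindrome.of_reverse_eq hp
  clear hp
  induction hp' with
  | nil => exact ⟨none, 0, rfl⟩
  | singleton a => exact ⟨some a, 0, rfl⟩
  | cons_concat a hl ih =>
    rename_i l
    have hlf : IsFactor u l := factor_of_sub hv ⟨[a], [a], by simp⟩
    obtain ⟨c, m, rfl⟩ := ih hlf
    obtain ⟨b, hb⟩ := chain_succ hall h c m
    have h1 := (chain_spec hall h c (m + 1)).1
    rw [hb] at h1
    have := h.unique hlf hl.reverse_eq hv h1
    exact ⟨c, m + 1, by rw [hb, this]⟩

lemma recur {u : ℕ → A} (hur : UniformlyRecurrent u) {w : List A} (hw : IsFactor u w) :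
    ∃ N, ∀ i n, N ≤ n → w <:+: word u i n := by
  obtain ⟨N, hN⟩ := hur w hw
  refine ⟨N + w.length, fun i n hn => ?_⟩
  obtain ⟨j, h1, h2, h3⟩ := hN i
  rw [infix_word]
  refine ⟨j - i, by omega, ?_⟩
  rw [show i + (j - i) = j by omega]
  exact occ_iff.1 h3

lemma chain_contains {u : ℕ → A} (hall : AllLettersOccur u) (hur : UniformlyRecurrent u)
    (h : PE u) {w : List A} (hw : IsFactor u w) (c : Option A) : ∃ m, w <:+: chain u c m := by
  obtain ⟨N, hN⟩ := recur hur hw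
  obtain ⟨i, hi⟩ := (chain_spec hall h c N).1
  refine ⟨N, ?_⟩
  rw [hi]
  exact hN _ _ (by rw [chain_length hall h]; omega)

lemma closed_rev {u : ℕ → A} (hall : AllLettersOccur u) (hur : UniformlyRecurrent u)
    (h : PE u) {w : List A} (hw : IsFactor u w) : IsFactor u w.reverse := by
  obtain ⟨m, hm⟩ := chain_contains hall hur h hw none
  obtain ⟨h1, h2⟩ := chain_spec hall h none m
  apply factor_of_sub h1
  rw [← h2]
  exact infix_rev hm

lemma chain_mono {u : ℕ → A} (hall : AllLettersOccur u) (h : PE u) (c : Option A) {m m' : ℕ}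
    (hm : m ≤ m') : chain u c m <:+: chain u c m' := by
  induction m', hm using Nat.le_induction with
  | base => exact List.infix_refl _
  | succ n _ ih =>
    obtain ⟨a, ha⟩ := chain_succ hall h c n
    rw [ha]
    exact ih.trans ⟨[a], [a], by simp⟩

/-- The palindromic gap words. -/
def palGaps (u : ℕ → A) (w : List A) : Set (List A) :=
  {v | ∃ i j, Gap u w i j ∧ v = word u i (j - i + w.length) ∧ v.reverse = v}

lemma palGaps_eq {u : ℕ → A} (hall : AllLettersOccur u) (hur : UniformlyRecurrent u)
    (h : PE u) {w : List A} (hw : IsFactor u w) :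
    ∃ V : Option A → List A, Function.Injective V ∧
      Set.range V = palGaps u w ∪ {v | v = w ∧ w.reverse = w} := by
  classical
  have hex := chain_contains hall hur h hw
  refine ⟨fun c => chain u c (Nat.find (hex c)), ?_, ?_⟩
  · intro c c' hc
    exact (chain_inj hall h _ _ _ _ hc).1
  apply Set.Subset.antisymm
  · rintro v ⟨c, rfl⟩
    have hm := Nat.find_spec (hex c)
    have hmin := fun q hq => Nat.find_min (hex c) (m := q) hq
    dsimp only
    generalize Nat.find (hex c) = m at hm hmin
    obtain ⟨hf, hp⟩ := chain_spec hall h c m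
    have hlen := chain_length hall h c m
    obtain ⟨i, hi⟩ := hf
    rw [occ_iff] at hi
    set n := (chain u c m).length with hn
    have hpal : (word u i n).reverse = word u i n := by rw [hi, hp]
    -- no occurrence strictly inside
    have hno1 : ∀ p, 0 < p → p + w.length < n → word u (i + p) w.length ≠ w := by
      intro p hp0 hpn he
      cases m with
      | zero => cases c <;> simp at hlen <;> omega
      | succ m =>
        obtain ⟨a, ha⟩ := chain_succ hall h c m
        apply hmin m (by omega)
        have hl' := chain_length hall h c m
        have hin : word u (i + 1) (chain u c m).length = chain u c m := by
          rw [ha, show n = 1 + ((chain u c m).length + 1) by omega, word_append,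
            word_append] at hi
          have h1 : word u i 1 ++ (word u (i + 1) (chain u c m).length ++
            word u (i + 1 + (chain u c m).length) 1) = [a] ++ (chain u c m ++ [a]) := hi
          have h2 := (List.append_inj h1 (by simp [word_length])).2
          exact (List.append_inj h2 (by simp [word_length])).1
        rw [← hin, infix_word]
        refine ⟨p - 1, by omega, ?_⟩
        rw [show i + 1 + (p - 1) = i + p by omega]
        exact he
    have hno : ∀ p, 0 < p → p + w.length < n → ¬ Occ u w (i + p) := by
      rintro p hp0 hpn (ho | ho)
      · exact hno1 p hp0 hpn ho
      · have := word_mirror hpal (p := p) (m := w.length) (q := n - w.length - p) (by omega)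
        rw [ho, List.reverse_reverse] at this
        exact hno1 (n - w.length - p) (by omega) (by omega) this.symm
    rw [← hi, infix_word] at hm
    obtain ⟨p, hp1, hp2⟩ := hm
    have hends : Occ u w i ∧ Occ u w (i + (n - w.length)) := by
      have hp3 : p = 0 ∨ p = n - w.length := by
        by_contra hc
        exact hno1 p (by omega) (by omega) hp2
      rcases hp3 with rfl | rfl
      · refine ⟨Or.inl hp2, Occ.rev (i := i) (Or.inl hp2) ?_⟩
        exact word_mirror hpal (p := 0) (by omega)
      · refine ⟨Occ.rev (i := i + (n - w.length)) (Or.inl hp2) ?_, Or.inl hp2⟩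
        exact word_mirror hpal (q := 0) (by omega)
    by_cases hnw : n = w.length
    · right
      have hp0 : p = 0 := by omega
      subst hp0
      have : chain u c m = w := by
        rw [← hi, ← hp2, hnw]; simp
      rw [this] at hp ⊢
      exact ⟨rfl, hp⟩
    · left
      refine ⟨i, i + (n - w.length), ⟨hends.1, hends.2, by omega, ?_⟩, ?_, hp⟩
      · intro l h1 h2
        have := hno (l - i) (by omega) (by omega)
        rwa [show i + (l - i) = l by omega] at this
      · rw [← hi]; congr 1; omega
  · rintro v (⟨i, j, ⟨hi, hj, hij, hbet⟩, hv, hvp⟩ | ⟨rfl, hvp⟩)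
    · have hvf : IsFactor u v := hv ▸ factor_word _ _ _
      obtain ⟨c, m, hcm⟩ := chain_complete hall h v hvf hvp
      refine ⟨c, ?_⟩
      dsimp only
      have : Nat.find (hex c) = m := by
        rw [Nat.find_eq_iff]
        constructor
        · rw [← hcm]
          rcases hi with hi | hi
          · rw [hv, infix_word]
            exact ⟨0, by omega, hi⟩
          · have hi2 : w.reverse <:+: v := by
              rw [hv, infix_word]
              exact ⟨0, by simp, by simpa using hi⟩
            have hi3 := infix_rev hi2
            rwa [List.reverse_reverse, hvp] at hi3
        · intro m' hm' hin
          obtain ⟨m, rfl⟩ : ∃ k, m = k + 1 := ⟨m - 1, by omega⟩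
          obtain ⟨a, ha⟩ := chain_succ hall h c m
          have hin2 := hin.trans (chain_mono hall h c (show m' ≤ m by omega))
          have hl : (chain u c m).length + 2 = j - i + w.length := by
            have h1 := congrArg List.length hcm
            have h2 := congrArg List.length hv
            rw [ha] at h1
            rw [word_length] at h2
            simp at h1
            omega
          have hin3 : word u (i + 1) (chain u c m).length = chain u c m := by
            rw [hcm, ha, ← hl, show (chain u c m).length + 2 = 1 + ((chain u c m).length + 1)
              by omega, word_append, word_append] at hv
            have h1 : word u i 1 ++ (word u (i + 1) (chain u c m).length ++
              word u (i + 1 + (chain u c m).length) 1) = [a] ++ (chain u c m ++ [a]) := hv.symm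
            have h2 := (List.append_inj h1 (by simp [word_length])).2
            exact (List.append_inj h2 (by simp [word_length])).1
          rw [← hin3, infix_word] at hin2
          obtain ⟨p, hp1, hp2⟩ := hin2
          exact hbet (i + 1 + p) (by omega) (by omega) (Or.inl hp2)
      rw [this, hcm]
    · obtain ⟨c, m, hcm⟩ := chain_complete hall h v hw hvp
      refine ⟨c, ?_⟩
      dsimp only
      have : Nat.find (hex c) = m := by
        rw [Nat.find_eq_iff]
        refine ⟨by rw [← hcm], ?_⟩
        intro m' hm' hin
        have := hin.length_le
        have h1 := congrArg List.length hcm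
        rw [chain_length hall h] at this h1
        omega
      rw [this, ← hcm]

lemma palGaps_ne {u : ℕ → A} {w : List A} : w ∉ palGaps u w := by
  rintro ⟨i, j, ⟨_, _, hij, _⟩, hv, _⟩
  have := congrArg List.length hv
  rw [word_length] at this
  omega

lemma palGaps_card_pal [Fintype A] {u : ℕ → A} (hall : AllLettersOccur u)
    (hur : UniformlyRecurrent u) (h : PE u) {w : List A} (hw : IsFactor u w)
    (hp : w.reverse = w) : (palGaps u w).ncard = Fintype.card A := by
  obtain ⟨V, hV, hr⟩ := palGaps_eq hall hur h hw
  have h1 : (Set.range V).ncard = Fintype.card A + 1 := by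
    rw [← Set.image_univ, Set.ncard_image_of_injective _ hV, Set.ncard_univ]
    simp
  have h2 : Set.range V = insert w (palGaps u w) := by
    rw [hr]; ext v; simp [hp]
  have hf : (palGaps u w).Finite := by
    apply (Set.finite_range V).subset; rw [h2]; exact Set.subset_insert _ _
  rw [h2, Set.ncard_insert_of_notMem palGaps_ne hf] at h1
  omega

lemma palGaps_card_nonpal [Fintype A] {u : ℕ → A} (hall : AllLettersOccur u)
    (hur : UniformlyRecurrent u) (h : PE u) {w : List A} (hw : IsFactor u w)
    (hp : w.reverse ≠ w) : (palGaps u w).ncard = Fintype.card A + 1 := by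
  obtain ⟨V, hV, hr⟩ := palGaps_eq hall hur h hw
  have h1 : (Set.range V).ncard = Fintype.card A + 1 := by
    rw [← Set.image_univ, Set.ncard_image_of_injective _ hV, Set.ncard_univ]
    simp
  have h2 : Set.range V = palGaps u w := by
    rw [hr]; ext v; simp [hp]
  rw [← h2, h1]


/-- Complete return words. -/
def complRet (u : ℕ → A) (w : List A) : Set (List A) :=
  {v | ∃ j k, SuccOccurrences u w j k ∧ v = word u j (k - j + w.length)}

lemma complRet_card (u : ℕ → A) (w : List A) :
    (returnWords u w).ncard = (complRet u w).ncard := by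
  have : complRet u w = (fun v => v ++ w) '' returnWords u w := by
    have key : ∀ j k, SuccOccurrences u w j k →
        word u j (k - j + w.length) = word u j (k - j) ++ w := by
      intro j k h
      rw [word_append, show j + (k - j) = k by have := h.2.2.1; omega, occ_iff.1 h.2.1]
    ext v
    constructor
    · rintro ⟨j, k, h, rfl⟩
      exact ⟨_, ⟨j, k, h, rfl⟩, (key j k h).symm⟩
    · rintro ⟨_, ⟨j, k, h, rfl⟩, rfl⟩
      exact ⟨j, k, h, (key j k h).symm⟩
  rw [this, Set.ncard_image_of_injective]
  intro a b hab
  exact List.append_cancel_right hab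

lemma complRet_finite [Fintype A] {u : ℕ → A} (hur : UniformlyRecurrent u) {w : List A}
    (hw : IsFactor u w) : (complRet u w).Finite := by
  obtain ⟨N, hN⟩ := hur w hw
  apply (List.finite_length_le A (N + w.length)).subset
  rintro v ⟨j, k, h, rfl⟩
  obtain ⟨l, h1, h2, h3⟩ := hN (j + 1)
  have : k ≤ l := by
    by_contra hc
    exact h.2.2.2 l (by omega) (by omega) h3
  change (word u j (k - j + w.length)).length ≤ N + w.length
  rw [word_length]
  omega

lemma occ_pal {u : ℕ → A} {w : List A} (hp : w.reverse = w) (i : ℕ) :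
    Occ u w i ↔ OccursAt u w i := by
  rw [occ_iff, Occ, hp, or_self]

lemma gap_pal {u : ℕ → A} {w : List A} (hp : w.reverse = w) (i j : ℕ) :
    Gap u w i j ↔ SuccOccurrences u w i j := by
  simp only [Gap, SuccOccurrences, occ_pal hp]

lemma palGaps_sub {u : ℕ → A} {w : List A} (hp : w.reverse = w) :
    palGaps u w ⊆ complRet u w := by
  rintro v ⟨i, j, hg, hv, -⟩
  exact ⟨i, j, (gap_pal hp i j).1 hg, hv⟩

/-- Counting along a sequence. -/
lemma count_seq {X Y : Type*} (x : ℕ → X) (f : ℕ → Y) (hx : (Set.range x).Finite)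
    (h : ∀ i, (∃ j, j ≤ i ∧ x j = x (i + 1)) ↔ (∃ j, j < i ∧ f j = f i)) :
    (Set.range f).ncard + 1 = (Set.range x).ncard := by
  have fx : ∀ n, (x '' Set.Iic n).Finite := fun n => (Set.finite_Iic n).image x
  have ff : ∀ n, (f '' Set.Iio n).Finite := fun n => (Set.finite_Iio n).image f
  have key : ∀ n, (f '' Set.Iio n).ncard + 1 = (x '' Set.Iic n).ncard := by
    intro n
    induction n with
    | zero =>
      have h2 : Set.Iic (0 : ℕ) = {0} := by ext; simp
      simp [h2]
    | succ n ih =>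
      have h1 : f '' Set.Iio (n + 1) = insert (f n) (f '' Set.Iio n) := by
        rw [← Set.image_insert_eq]; congr 1; ext; simp only [Set.mem_Iio, Set.mem_insert_iff]; omega
      have h2 : x '' Set.Iic (n + 1) = insert (x (n + 1)) (x '' Set.Iic n) := by
        rw [← Set.image_insert_eq]; congr 1; ext; simp only [Set.mem_Iic, Set.mem_insert_iff]; omega
      rw [h1, h2]
      by_cases hc : ∃ j, j < n ∧ f j = f n
      · have hc' := (h n).2 hc
        obtain ⟨j, hj, e⟩ := hc
        obtain ⟨j', hj', e'⟩ := hc'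
        have m1 : f n ∈ f '' Set.Iio n := ⟨j, hj, e⟩
        have m2 : x (n + 1) ∈ x '' Set.Iic n := ⟨j', hj', e'⟩
        rw [Set.insert_eq_of_mem m1, Set.insert_eq_of_mem m2, ih]
      · have hc' := fun hh => hc ((h n).1 hh)
        rw [Set.ncard_insert_of_notMem _ (ff n), Set.ncard_insert_of_notMem _ (fx n), ih]
        · rintro ⟨j', hj', e'⟩; exact hc' ⟨j', hj', e'⟩
        · rintro ⟨j', hj', e'⟩; exact hc ⟨j', hj', e'⟩
  obtain ⟨N, hN⟩ : ∃ N, ∀ n, N ≤ n → x '' Set.Iic n = Set.range x := by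
    choose g hg using fun y : Set.range x => y.2
    have := hx.to_subtype
    obtain ⟨N, hN⟩ := (Set.finite_range g).bddAbove
    refine ⟨N, fun n hn => Set.Subset.antisymm (Set.image_subset_range _ _) ?_⟩
    intro y hy
    exact ⟨g ⟨y, hy⟩, (hN ⟨_, rfl⟩).trans hn, hg ⟨y, hy⟩⟩
  have hf : ∀ n, N ≤ n → f '' Set.Iio N = f '' Set.Iio n := by
    intro n hn
    apply Set.eq_of_subset_of_ncard_le _ _ (ff n)
    · exact Set.image_mono (Set.Iio_subset_Iio hn)
    · have h1 := key N
      have h2 := key n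
      rw [hN _ le_rfl] at h1
      rw [hN n hn] at h2
      omega
  have hrf : Set.range f = f '' Set.Iio N := by
    apply Set.Subset.antisymm _ (Set.image_subset_range _ _)
    rintro _ ⟨m, rfl⟩
    rw [hf (max N (m + 1)) (le_max_left _ _)]
    exact ⟨m, by simp, rfl⟩
  rw [hrf, key, hN N le_rfl]

lemma nonpal_count [Fintype A] {u : ℕ → A} (hall : AllLettersOccur u)
    (hur : UniformlyRecurrent u) (h : PE u) (hr : Rich u) {w : List A} (hw : IsFactor u w)
    (hp : w.reverse ≠ w) : (complRet u w).ncard = Fintype.card A := by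
  classical
  have hinf : (Set.ofPred (Occ u w)).Infinite := by
    obtain ⟨N, hN⟩ := hur w hw
    rw [Set.infinite_iff_exists_gt]
    intro a
    obtain ⟨j, h1, h2, h3⟩ := hN (a + 1)
    exact ⟨j, Or.inl (occ_iff.1 h3), by omega⟩
  obtain ⟨t, tmono, tocc, tsurj⟩ : ∃ t : ℕ → ℕ, StrictMono t ∧ (∀ m, Occ u w (t m)) ∧
      ∀ l, Occ u w l → ∃ m, t m = l :=
    ⟨Nat.nth (Occ u w), Nat.nth_strictMono hinf, Nat.nth_mem_of_infinite hinf,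
      fun l hl => ⟨_, Nat.nth_count hl⟩⟩
  have tlt : ∀ m, t m < t (m + 1) := fun m => tmono (by omega)
  have tlt2 : ∀ m, t (m + 1) < t (m + 2) := fun m => tmono (by omega)
  have hnext : ∀ m l, Occ u w l → t m < l → t (m + 1) ≤ l := by
    intro m l hl hml
    obtain ⟨s, rfl⟩ := tsurj l hl
    exact tmono.monotone (tmono.lt_iff_lt.1 hml)
  have hmid : ∀ m l, Occ u w l → t m < l → l < t (m + 2) → l = t (m + 1) := by
    intro m l hl h1 h2
    obtain ⟨s, rfl⟩ := tsurj l hl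
    have h1 := tmono.lt_iff_lt.1 h1
    have h2 := tmono.lt_iff_lt.1 h2
    congr 1; omega
  have hgap : ∀ m, Gap u w (t m) (t (m + 1)) := by
    intro m
    refine ⟨tocc _, tocc _, tlt m, fun l h1 h2 ho => ?_⟩
    have := hnext m l ho h1
    omega
  set n := w.length with hn
  let x : ℕ → List A := fun m => word u (t m) (t (m + 1) - t m + n)
  let R : ℕ → List A := fun m => word u (t m) (t (m + 2) - t m + n)
  let f : ℕ → List A := fun m => if word u (t m) n = w then R m else (R m).reverse
  have xpal : ∀ m, (word u (t m) (t (m + 1) - t m + n)).reverse =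
      word u (t m) (t (m + 1) - t m + n) := fun m => rich_gap hr (hgap m)
  have alt : ∀ m, word u (t (m + 1)) n = (word u (t m) n).reverse := by
    intro m
    have := word_mirror (xpal m) (p := 0) (m := n) (q := t (m + 1) - t m) (by omega)
    rw [show t m + (t (m + 1) - t m) = t (m + 1) by have := tlt m; omega] at this
    exact this.symm
  have alt2 : ∀ m, word u (t (m + 2)) n = word u (t m) n := by
    intro m
    rw [alt (m + 1), alt m, List.reverse_reverse]
  have nonp : ∀ m, (word u (t m) n).reverse ≠ word u (t m) n := by
    intro m he
    rcases tocc m with ho | ho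
    · rw [ho] at he; exact hp he
    · rw [ho] at he; rw [List.reverse_reverse] at he; exact hp he.symm
  -- occurrences of a gap word
  have xocc : ∀ i q, word u q (t (i + 1) - t i + n) = x i → ∃ s, t s = q ∧ x s = x i := by
    intro i q hq
    have hti := tlt i
    have hq0 : Occ u w q := by
      refine (tocc i).congr ?_
      have := word_sub hq (p := 0) (m := n) (by omega)
      exact this.symm
    obtain ⟨s, rfl⟩ := tsurj q hq0
    refine ⟨s, rfl, ?_⟩
    have hts := tlt s
    have h1 : Occ u w (t s + (t (i + 1) - t i)) := by
      refine (tocc (i + 1)).congr ?_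
      have := word_sub hq (p := t (i + 1) - t i) (m := n) (by omega)
      rw [show t i + (t (i + 1) - t i) = t (i + 1) by omega] at this
      exact this.symm
    have h2 := hnext s _ h1 (by omega)
    have h3 : Occ u w (t i + (t (s + 1) - t s)) := by
      refine (tocc (s + 1)).congr ?_
      have := word_sub hq (p := t (s + 1) - t s) (m := n) (by omega)
      rw [show t s + (t (s + 1) - t s) = t (s + 1) by omega] at this
      exact this
    have h4 := hnext i _ h3 (by omega)
    rw [← hq]
    change word u (t s) (t (s + 1) - t s + n) = _
    congr 1; omega
  have xlen : ∀ m, (x m).length = t (m + 1) - t m + n := fun m => word_length _ _ _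
  have Rlen : ∀ m, (R m).length = t (m + 2) - t m + n := fun m => word_length _ _ _
  have hxr : Set.range x = palGaps u w := by
    ext v
    constructor
    · rintro ⟨m, rfl⟩
      exact ⟨t m, t (m + 1), hgap m, rfl, xpal m⟩
    · rintro ⟨i, j, ⟨hi, hj, hij, hb⟩, rfl, -⟩
      obtain ⟨m, rfl⟩ := tsurj i hi
      have : t (m + 1) = j := by
        have h1 := hnext m j hj hij
        by_contra hc
        exact hb (t (m + 1)) (tlt m) (by omega) (tocc _)
      subst this
      exact ⟨m, rfl⟩
  have hfr : Set.range f = complRet u w := by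
    ext v
    constructor
    · rintro ⟨m, rfl⟩
      have h01 := tlt m
      have h12 := tlt2 m
      by_cases hm : word u (t m) n = w
      · refine ⟨t m, t (m + 2), ⟨occ_iff.2 hm, occ_iff.2 ?_, by omega, ?_⟩, ?_⟩
        · rw [← hn, alt2, hm]
        · intro l h1 h2 ho
          rw [occ_iff] at ho
          have := hmid m l (Or.inl ho) h1 h2
          subst this
          rw [← hn, alt, hm] at ho
          exact hp ho
        · simp only [f, if_pos hm]; rfl
      · have hm' : word u (t m) n = w.reverse := by
          rcases tocc m with ho | ho
          · exact absurd ho hm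
          · exact ho
        obtain ⟨a, ha⟩ := closed_rev hall hur h (factor_word u (t m) (t (m + 2) - t m + n))
        rw [occ_iff, List.length_reverse, word_length] at ha
        have ha := ha.symm
        refine ⟨a, a + (t (m + 2) - t m), ⟨occ_iff.2 ?_, occ_iff.2 ?_, by omega, ?_⟩, ?_⟩
        · have := word_mirror ha (p := t (m + 2) - t m) (m := n) (q := 0) (by omega)
          rw [show t m + (t (m + 2) - t m) = t (m + 2) by omega, alt2, hm',
            List.reverse_reverse] at this
          exact this.symm
        · have := word_mirror ha (p := 0) (m := n) (q := t (m + 2) - t m) (by omega)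
          rw [add_zero, hm', List.reverse_reverse] at this
          exact this.symm
        · intro l h1 h2 ho
          rw [occ_iff] at ho
          have := word_mirror ha (p := t (m + 2) - t m - (l - a)) (m := n) (q := l - a) (by omega)
          rw [show a + (l - a) = l by omega, ho] at this
          have this' := congrArg List.reverse this
          rw [List.reverse_reverse] at this'
          have h3 := hmid m _ (Or.inr this') (by omega) (by omega)
          rw [h3, alt, hm', List.reverse_reverse] at this'
          exact hp this'.symm
        · simp only [f, if_neg hm]
          rw [show a + (t (m + 2) - t m) - a = t (m + 2) - t m by omega, ← hn, ← ha]
    · rintro ⟨a, b, ⟨ha, hb, hab, hbet⟩, rfl⟩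
      rw [occ_iff] at ha hb
      obtain ⟨m, rfl⟩ := tsurj a (Or.inl ha)
      have h01 := tlt m
      have h12 := tlt2 m
      refine ⟨m, ?_⟩
      have : t (m + 2) = b := by
        have h1 := hnext m b (Or.inl hb) hab
        have h2 : t (m + 1) ≠ b := by
          rintro rfl
          rw [← hn, alt, ha] at hb
          exact hp hb
        have h3 : t (m + 2) ≤ b := hnext (m + 1) b (Or.inl hb) (by omega)
        by_contra hc
        refine hbet (t (m + 2)) (by omega) (by omega) (occ_iff.2 ?_)
        rw [← hn, alt2, ha]
      subst this
      rw [← hn] at ha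
      simp only [f, if_pos ha]; rfl
  have main : ∀ i, (∃ j, j ≤ i ∧ x j = x (i + 1)) ↔ (∃ j, j < i ∧ f j = f i) := by
    intro i
    constructor
    · rintro ⟨l0, hl0, e0⟩
      obtain ⟨l, hl, e, hlast⟩ := last_before (fun s => x s = x (i + 1)) l0 (i + 1) e0 (by omega)
      have hl01 := tlt l
      have hl12 := tlt2 l
      have hi01 := tlt i
      have hi12 := tlt2 i
      have hlen : t (l + 1) - t l = t (i + 2) - t (i + 1) := by
        have := congrArg List.length e
        rw [xlen, xlen] at this
        change t (l + 1) - t l + n = t (i + 2) - t (i + 1) + n at this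
        omega
      have hli : l < i := by
        by_contra hc
        have : l = i := by omega
        subst this
        have e' : word u (t l) (t (l + 1) - t l + n) =
          word u (t (l + 1)) (t (l + 1) - t l + n) := by
          have e1 : word u (t l) (t (l + 1) - t l + n) =
            word u (t (l + 1)) (t (l + 2) - t (l + 1) + n) := e
          rw [hlen] at e1 ⊢; exact e1
        have := word_sub e' (p := 0) (m := n) (by omega)
        rw [add_zero, add_zero, alt] at this
        exact nonp l this.symm
      have hlt : t l < t i := tmono hli
      have hl2 : t (l + 2) ≤ t (i + 1) := tmono.monotone (by omega)
      have hzp : (x (i + 1)).reverse = x (i + 1) := xpal (i + 1)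
      have hg : Gap u (x (i + 1)) (t l) (t (i + 1)) := by
        refine ⟨Or.inl ?_, Or.inl ?_, by omega, ?_⟩
        · rw [← e, xlen]
        · rw [xlen]
        · intro q h1 h2 ho
          rw [occ_pal hzp, occ_iff, xlen] at ho
          obtain ⟨s, rfl, hs⟩ := xocc (i + 1) q ho
          exact hlast s (tmono.lt_iff_lt.1 h1) (tmono.lt_iff_lt.1 h2) hs
      have hP := rich_gap hr hg
      rw [xlen, show t (i + 1) - t l + (t (i + 1 + 1) - t (i + 1) + n) = t (i + 2) - t l + n by
        change t (i + 1) - t l + (t (i + 2) - t (i + 1) + n) = _; omega] at hP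
      have hq0 : Occ u w (t l + (t (i + 2) - t i)) := by
        refine (tocc i).rev ?_
        have := word_mirror hP (p := t i - t l) (m := n) (q := t (i + 2) - t i) (by omega)
        rw [show t l + (t i - t l) = t i by omega] at this
        exact this
      have h5 := hnext (l + 1) _ hq0 (by omega)
      change t (l + 2) ≤ _ at h5
      have hy : Occ u w (t l + (t (i + 2) - t (l + 2))) := by
        refine (tocc (l + 2)).rev ?_
        have := word_mirror hP (p := t (l + 2) - t l) (m := n) (q := t (i + 2) - t (l + 2))
          (by omega)
        rw [show t l + (t (l + 2) - t l) = t (l + 2) by omega] at this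
        exact this
      have h6 : t l + (t (i + 2) - t (l + 2)) = t i := by
        by_contra hc
        have := hnext i _ hy (by omega)
        omega
      have hRR : (R i).reverse = R l := by
        have := word_mirror hP (p := t i - t l) (m := t (i + 2) - t i + n) (q := 0) (by omega)
        rw [show t l + (t i - t l) = t i by omega, add_zero] at this
        change (word u (t i) (t (i + 2) - t i + n)).reverse = word u (t l) (t (l + 2) - t l + n)
        rw [this]; congr 1; omega
      have hty : (word u (t i) n).reverse = word u (t l) n := by
        have := word_mirror hP (p := t (i + 2) - t l) (m := n) (q := 0) (by omega)
        rw [show t l + (t (i + 2) - t l) = t (i + 2) by omega, add_zero, alt2] at this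
        exact this
      refine ⟨l, hli, ?_⟩
      by_cases hc : word u (t i) n = w
      · have hc' : word u (t l) n ≠ w := by
          rw [← hty, hc]; exact hp
        simp only [f, if_pos hc, if_neg hc', ← hRR, List.reverse_reverse]
      · have hc' : word u (t l) n = w := by
          rcases tocc i with ho | ho
          · exact absurd ho hc
          · rw [← hty, ho, List.reverse_reverse]
        simp only [f, if_neg hc, if_pos hc', hRR]
    · rintro ⟨j, hj, e⟩
      have hl01 := tlt j
      have hl12 := tlt2 j
      have hi01 := tlt i
      have hi12 := tlt2 i
      have hcases : R i = R j ∨ (R i).reverse = R j := by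
        simp only [f] at e
        split_ifs at e
        · exact Or.inl e.symm
        · exact Or.inr e.symm
        · right; rw [← e, List.reverse_reverse]
        · left; exact (List.reverse_injective e).symm
      have hlen : t (i + 2) - t i = t (j + 2) - t j := by
        have : (R i).length = (R j).length := by
          rcases hcases with e | e
          · rw [e]
          · rw [← e, List.length_reverse]
        rw [Rlen, Rlen] at this
        omega
      rcases hcases with e | e
      · change word u (t i) (t (i + 2) - t i + n) = word u (t j) (t (j + 2) - t j + n) at e
        rw [← hlen] at e
        refine ⟨j + 1, by omega, ?_⟩
        have h1 : Occ u w (t j + (t (i + 1) - t i)) := by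
          refine (tocc (i + 1)).congr ?_
          have := word_sub e (p := t (i + 1) - t i) (m := n) (by omega)
          rw [show t i + (t (i + 1) - t i) = t (i + 1) by omega] at this
          exact this
        have h2 := hmid j _ h1 (by omega) (by omega)
        have := word_sub e (p := t (i + 1) - t i) (m := t (i + 2) - t (i + 1) + n) (by omega)
        rw [h2, show t i + (t (i + 1) - t i) = t (i + 1) by omega] at this
        change word u (t (j + 1)) (t (j + 2) - t (j + 1) + n) =
          word u (t (i + 1)) (t (i + 2) - t (i + 1) + n)
        rw [this]; congr 1; omega
      · change (word u (t i) (t (i + 2) - t i + n)).reverse =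
          word u (t j) (t (j + 2) - t j + n) at e
        rw [← hlen] at e
        refine ⟨j, by omega, ?_⟩
        have h1 : Occ u w (t j + (t (i + 2) - t (i + 1))) := by
          refine (tocc (i + 1)).rev ?_
          have := word_mirror e (p := t (i + 1) - t i) (m := n) (q := t (i + 2) - t (i + 1))
            (by omega)
          rw [show t i + (t (i + 1) - t i) = t (i + 1) by omega] at this
          exact this
        have h2 := hmid j _ h1 (by omega) (by omega)
        have := word_mirror e (p := t (i + 1) - t i) (m := t (i + 2) - t (i + 1) + n) (q := 0)
          (by omega)
        rw [show t i + (t (i + 1) - t i) = t (i + 1) by omega, add_zero] at this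
        have h3 := xpal (i + 1)
        change (word u (t (i + 1)) (t (i + 2) - t (i + 1) + n)).reverse =
          word u (t (i + 1)) (t (i + 2) - t (i + 1) + n) at h3
        change word u (t j) (t (j + 1) - t j + n) =
          word u (t (i + 1)) (t (i + 2) - t (i + 1) + n)
        rw [← h3, this]; congr 1; omega
  have hcard := palGaps_card_nonpal hall hur h hw hp
  have hfin : (Set.range x).Finite := by
    rw [hxr]
    exact Set.finite_of_ncard_pos (by omega)
  have := count_seq x f hfin main
  rw [hxr, hfr] at this
  omega

end PR

/-- For a uniformly recurrent infinite word over a `k`-letter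
alphabet satisfying Property PE: `u` is rich iff every factor has exactly `k`
return words. -/
theorem stmt18 {A : Type*} [Fintype A] (u : ℕ → A)
    (hall : AllLettersOccur u)
    (hur : UniformlyRecurrent u)
    (hPE : ∀ w : List A, IsFactor u w → w.reverse = w →
      Set.ncard (Pext u w) = 1) :
    Rich u ↔ ∀ w : List A, IsFactor u w →
      Set.ncard (returnWords u w) = Fintype.card A := by
  constructor
  · intro hr w hw
    rw [PR.complRet_card]
    by_cases hp : w.reverse = w
    · rw [← PR.palGaps_card_pal hall hur hPE hw hp]
      congr 1
      refine Set.Subset.antisymm ?_ (PR.palGaps_sub hp)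
      rintro v ⟨i, j, hs, rfl⟩
      have hg := (PR.gap_pal hp i j).2 hs
      exact ⟨i, j, hg, rfl, PR.rich_gap hr hg⟩
    · exact PR.nonpal_count hall hur hPE hr hw hp
  · intro hR
    apply PR.rich_of_ret
    intro w hp i j hs
    have hw : IsFactor u w := ⟨i, hs.1⟩
    have heq : PR.palGaps u w = PR.complRet u w := by
      apply Set.eq_of_subset_of_ncard_le (PR.palGaps_sub hp) _ (PR.complRet_finite hur hw)
      rw [← PR.complRet_card, hR w hw, PR.palGaps_card_pal hall hur hPE hw hp]
    have hm : word u i (j - i + w.length) ∈ PR.complRet u w := ⟨i, j, hs, rfl⟩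
    rw [← heq] at hm
    obtain ⟨_, _, _, _, h⟩ := hm
    exact h
end
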